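/- arXiv:1911.08214 — 13 statements merged into one kernel-verified Lean document; each statement's English description precedes it below -/
import Mathlib

section
/- If g is the inner product on 𝔪 given by g = Σᵢ x_i π_{𝔪_i}*Q with x₁,…,xₛ > 0 (i.e. the 𝔪_i are g-orthogonal and g = x_i·Q on 𝔪_i), then −(1/2)·tr_g B|_𝔪 − (1/4)·|Δ(𝔪,𝔪,𝔪)|_g² = (1/2)·Σᵢ d_i b_i / x_i − (1/4)·Σ_{i,j,k} [ijk] · x_k/(x_i x_j). -/
open scoped BigOperators

/-- `⟨𝔲₁𝔲₂𝔲₃⟩ = Σ_{a,b,c} Q([f_b, g_c], e_a)²`, computed from `Q`-orthonormal bases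
`e`, `f`, `g` of the subspaces 𝔲₁, 𝔲₂, 𝔲₃. -/
def bracketNormSq {𝔤 : Type*} [LieRing 𝔤] [LieAlgebra ℝ 𝔤]
    (Q : 𝔤 →ₗ[ℝ] 𝔤 →ₗ[ℝ] ℝ) {n₁ n₂ n₃ : ℕ}
    (e : Fin n₁ → 𝔤) (f : Fin n₂ → 𝔤) (g : Fin n₃ → 𝔤) : ℝ :=
  ∑ a, ∑ b, ∑ c, (Q ⁅f b, g c⁆ (e a)) ^ 2

theorem aux_expand {V ι : Type*} [AddCommGroup V] [Module ℝ V] [Fintype ι] [DecidableEq ι]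
    (G : V →ₗ[ℝ] V →ₗ[ℝ] ℝ) (w : ι → V)
    (hw : ∀ p q, G (w p) (w q) = if p = q then 1 else 0) (v : V)
    (hv : v ∈ Submodule.span ℝ (Set.range w)) : v = ∑ p, G v (w p) • w p := by
  induction hv using Submodule.span_induction with
  | mem y hy =>
    obtain ⟨q, rfl⟩ := hy
    simp [hw]
  | zero => simp
  | add y z _ _ hy hz =>
    conv_lhs => rw [hy, hz]
    simp [add_smul, Finset.sum_add_distrib]
  | smul c y _ hy =>
    conv_lhs => rw [hy]
    simp [Finset.smul_sum, mul_smul]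

theorem aux_trace {V ι κ : Type*} [AddCommGroup V] [Module ℝ V] [Fintype ι] [Fintype κ]
    (u : ι → V) (w : κ → V) (A : ι → κ → ℝ) (c : κ → ℝ)
    (hu : ∀ a, u a = ∑ p, (c p * A a p) • w p) (hw : ∀ p, w p = ∑ a, A a p • u a)
    (F : V →ₗ[ℝ] V →ₗ[ℝ] ℝ) : ∑ a, F (u a) (u a) = ∑ p, c p * F (w p) (w p) := by
  have h1 : ∀ a, F (u a) (u a) = ∑ p, c p * (A a p * F (w p) (u a)) := by
    intro a
    have gen : ∀ y, F (u a) y = ∑ p, c p * (A a p * F (w p) y) := by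
      intro y
      rw [hu a, map_sum, LinearMap.sum_apply]
      simp [mul_assoc]
    exact gen (u a)
  have h2 : ∀ p, F (w p) (w p) = ∑ a, A a p * F (w p) (u a) := by
    intro p
    conv_lhs => rw [hw p, map_sum]
    rw [← hw p]
    simp
  simp_rw [h1, h2, Finset.mul_sum]
  exact Finset.sum_comm

/-- If `g = Σᵢ xᵢ π_{𝔪ᵢ}* Q` with `xᵢ > 0`, then
`−(1/2)·tr_g B|𝔪 − (1/4)·|Δ(𝔪,𝔪,𝔪)|_g² = (1/2)·Σᵢ dᵢbᵢ/xᵢ − (1/4)·Σ_{i,j,k}[ijk]·x_k/(x_i x_j)`. -/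
theorem stmt1 {𝔤 : Type*} [LieRing 𝔤] [LieAlgebra ℝ 𝔤] [FiniteDimensional ℝ 𝔤]
    (Q : 𝔤 →ₗ[ℝ] 𝔤 →ₗ[ℝ] ℝ)
    (hQsymm : ∀ v w, Q v w = Q w v)
    (hQpos : ∀ v, v ≠ 0 → 0 < Q v v)
    (hQad : ∀ z v w : 𝔤, Q ⁅z, v⁆ w + Q v ⁅z, w⁆ = 0)
    -- the subspace 𝔪 and its Q-orthogonal decomposition 𝔪 = 𝔪₁ ⊕ ⋯ ⊕ 𝔪ₛ
    (𝔪 : Submodule ℝ 𝔤) {s : ℕ} (msub : Fin s → Submodule ℝ 𝔤)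
    (hsub : ∀ i, msub i ≤ 𝔪) (hnz : ∀ i, msub i ≠ ⊥)
    (horth : ∀ i j, i ≠ j → ∀ v ∈ msub i, ∀ w ∈ msub j, Q v w = 0)
    (hsup : (⨆ i, msub i) = 𝔪)
    -- Q-orthonormal bases of the summands, dᵢ = dim 𝔪ᵢ
    (d : Fin s → ℕ) (e : ∀ i, Fin (d i) → 𝔤)
    (he_mem : ∀ i a, e i a ∈ msub i)
    (he_span : ∀ i, Submodule.span ℝ (Set.range (e i)) = msub i)
    (he_on : ∀ i a b, Q (e i a) (e i b) = if a = b then 1 else 0)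
    -- B = −bᵢ Q on 𝔪ᵢ
    (b : Fin s → ℝ)
    (hb : ∀ i, ∀ v ∈ msub i, ∀ w ∈ msub i, killingForm ℝ 𝔤 v w = -(b i) * Q v w)
    -- Q-orthogonal projections πᵢ onto 𝔪ᵢ
    (π : Fin s → (𝔤 →ₗ[ℝ] 𝔤))
    (hπ_mem : ∀ i v, π i v ∈ msub i)
    (hπ_id : ∀ i, ∀ v ∈ msub i, π i v = v)
    (hπ_orth : ∀ i v, ∀ w ∈ msub i, Q (v - π i v) w = 0)
    -- the inner product g = Σᵢ xᵢ π_{𝔪ᵢ}* Q, with xᵢ > 0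
    (x : Fin s → ℝ) (hx : ∀ i, 0 < x i)
    (g : 𝔤 → 𝔤 → ℝ)
    (hg : ∀ v w, g v w = ∑ i, x i * Q (π i v) (π i w))
    -- a g-orthonormal basis of 𝔪
    {N : ℕ} (u : Fin N → 𝔤)
    (hu_mem : ∀ a, u a ∈ 𝔪)
    (hu_span : Submodule.span ℝ (Set.range u) = 𝔪)
    (hu_on : ∀ a b, g (u a) (u b) = if a = b then 1 else 0)
    -- the Q-orthogonal projection onto 𝔪
    (πm : 𝔤 →ₗ[ℝ] 𝔤)
    (hπm_mem : ∀ v, πm v ∈ 𝔪) (hπm_id : ∀ v ∈ 𝔪, πm v = v)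
    (hπm_orth : ∀ v, ∀ w ∈ 𝔪, Q (v - πm v) w = 0) :
    -(1/2) * (∑ a, killingForm ℝ 𝔤 (u a) (u a))
        - (1/4) * (∑ a, ∑ b', g (πm ⁅u a, u b'⁆) (πm ⁅u a, u b'⁆))
      = (1/2) * (∑ i, (d i : ℝ) * b i / x i)
        - (1/4) * (∑ i, ∑ j, ∑ k,
            bracketNormSq Q (e i) (e j) (e k) * x k / (x i * x j)) := by
  classical
  have hQ0 : ∀ v, Q v v = 0 → v = 0 := by
    intro v hv
    by_contra h
    exact absurd hv (hQpos v h).ne'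
  have hπQ : ∀ i v, ∀ w ∈ msub i, Q (π i v) w = Q v w := by
    intro i v w hw
    have := hπ_orth i v w hw
    simp only [map_sub, LinearMap.sub_apply] at this
    linarith
  have hπmQ : ∀ v, ∀ w ∈ 𝔪, Q (πm v) w = Q v w := by
    intro v w hw
    have := hπm_orth v w hw
    simp only [map_sub, LinearMap.sub_apply] at this
    linarith
  have hπ0 : ∀ i j, i ≠ j → ∀ v ∈ msub i, π j v = 0 := by
    intro i j hij v hv
    apply hQ0
    rw [hπQ j v _ (hπ_mem j v)]
    exact horth i j hij v hv _ (hπ_mem j v)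
  let G : 𝔤 →ₗ[ℝ] 𝔤 →ₗ[ℝ] ℝ := ∑ i, x i • (Q.compl₁₂ (π i) (π i))
  have hG : ∀ v w, g v w = G v w := by
    intro v w
    simp [G, hg, LinearMap.sum_apply]
  have hGe : ∀ v i, ∀ w ∈ msub i, G v w = x i * Q v w := by
    intro v i w hw
    rw [← hG, hg, Finset.sum_eq_single i]
    · rw [hπ_id i w hw, hπQ i v w hw]
    · intro j _ hj
      rw [hπ0 i j hj.symm w hw]
      simp
    · simp
  have hGsymm : ∀ v w, G v w = G w v := by
    intro v w
    rw [← hG, ← hG, hg, hg]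
    exact Finset.sum_congr rfl fun i _ => by rw [hQsymm]
  let w : (Σ i, Fin (d i)) → 𝔤 := fun p => e p.1 p.2
  have hwspan : Submodule.span ℝ (Set.range w) = 𝔪 := by
    have : Set.range w = ⋃ i, Set.range (e i) := by
      ext y
      simp [w]
    rw [this, Submodule.span_iUnion, ← hsup]
    exact iSup_congr he_span
  have hwon : ∀ p q, Q (w p) (w q) = if p = q then 1 else 0 := by
    rintro ⟨i, a⟩ ⟨j, c⟩
    by_cases hij : i = j
    · subst hij
      simp [w, he_on]
    · have : (⟨i, a⟩ : Σ i, Fin (d i)) ≠ ⟨j, c⟩ := by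
        intro h
        exact hij (congrArg Sigma.fst h)
      rw [if_neg this]
      exact horth i j hij _ (he_mem i a) _ (he_mem j c)
  have hwm : ∀ p, w p ∈ 𝔪 := fun p => hsub p.1 (he_mem p.1 p.2)
  have key : ∀ F : 𝔤 →ₗ[ℝ] 𝔤 →ₗ[ℝ] ℝ,
      ∑ a, F (u a) (u a) = ∑ p, (x p.1)⁻¹ * F (w p) (w p) := by
    intro F
    refine aux_trace u w (fun a p => G (w p) (u a)) (fun p => (x p.1)⁻¹) ?_ ?_ F
    · intro a
      have h := aux_expand Q w hwon (u a) (by rw [hwspan]; exact hu_mem a)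
      conv_lhs => rw [h]
      refine Finset.sum_congr rfl fun p _ => ?_
      rw [hGsymm, hGe (u a) p.1 (w p) (he_mem p.1 p.2),
        inv_mul_cancel_left₀ (hx p.1).ne']
    · intro p
      exact aux_expand G u (fun a b => by rw [← hG, hu_on]) (w p)
        (by rw [hu_span]; exact hwm p)
  have hQQ : ∀ k v, Q (π k v) (π k v) = ∑ c, Q v (e k c) ^ 2 := by
    intro k v
    have h := aux_expand Q (e k) (he_on k) (π k v) (by rw [he_span]; exact hπ_mem k v)
    conv_lhs => rw [h, map_sum]
    rw [← h]
    refine Finset.sum_congr rfl fun c _ => ?_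
    rw [map_smul, smul_eq_mul, hπQ k v _ (he_mem k c), sq]
  have hGG : ∀ v, G (πm v) (πm v) = ∑ k, x k * ∑ c, Q v (e k c) ^ 2 := by
    intro v
    rw [← hG, hg]
    refine Finset.sum_congr rfl fun k _ => ?_
    rw [hQQ]
    congr 1
    refine Finset.sum_congr rfl fun c _ => ?_
    rw [hπmQ v _ (hsub k (he_mem k c))]
  have hcyc : ∀ p q r : 𝔤, Q ⁅q, r⁆ p = Q ⁅p, q⁆ r := by
    intro p q r
    have h := hQad q r p
    rw [← lie_skew p q, map_neg, LinearMap.neg_apply, hQsymm ⁅q, p⁆ r]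
    linarith
  have hA : ∑ a, killingForm ℝ 𝔤 (u a) (u a) = - ∑ i, (d i : ℝ) * b i / x i := by
    rw [key, Fintype.sum_sigma, ← Finset.sum_neg_distrib]
    refine Finset.sum_congr rfl fun i _ => ?_
    have : ∀ a, (x i)⁻¹ * killingForm ℝ 𝔤 (w ⟨i, a⟩) (w ⟨i, a⟩) = (x i)⁻¹ * -(b i) := by
      intro a
      rw [hb i _ (he_mem i a) _ (he_mem i a), he_on]
      simp
    rw [Finset.sum_congr rfl fun a _ => this a]
    simp
    ring
  have hB : ∑ a, ∑ b', g (πm ⁅u a, u b'⁆) (πm ⁅u a, u b'⁆)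
      = ∑ p, ∑ q, (x p.1)⁻¹ * ((x q.1)⁻¹ * G (πm ⁅w p, w q⁆) (πm ⁅w p, w q⁆)) := by
    have h1 : ∀ z : 𝔤, ∑ b', G (πm ⁅z, u b'⁆) (πm ⁅z, u b'⁆)
        = ∑ q, (x q.1)⁻¹ * G (πm ⁅z, w q⁆) (πm ⁅z, w q⁆) := by
      intro z
      exact key (G.compl₁₂ (πm ∘ₗ (LieAlgebra.ad ℝ 𝔤 z : 𝔤 →ₗ[ℝ] 𝔤))
        (πm ∘ₗ (LieAlgebra.ad ℝ 𝔤 z : 𝔤 →ₗ[ℝ] 𝔤)))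
    have h2 : ∀ y z : 𝔤, G (πm ⁅y, z⁆) (πm ⁅y, z⁆) = G (πm ⁅z, y⁆) (πm ⁅z, y⁆) := by
      intro y z
      rw [← lie_skew y z, map_neg, map_neg, map_neg, LinearMap.neg_apply, neg_neg]
    simp_rw [hG, h1]
    rw [Finset.sum_comm]
    conv_rhs => rw [Finset.sum_comm]
    refine Finset.sum_congr rfl fun q _ => ?_
    have h3 := h1 (w q)
    simp_rw [h2 (w q)] at h3
    rw [← Finset.mul_sum, h3, Finset.mul_sum]
    refine Finset.sum_congr rfl fun p _ => ?_
    ring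
  have hC : ∑ p, ∑ q, (x p.1)⁻¹ * ((x q.1)⁻¹ * G (πm ⁅w p, w q⁆) (πm ⁅w p, w q⁆))
      = ∑ i, ∑ j, ∑ k, bracketNormSq Q (e i) (e j) (e k) * x k / (x i * x j) := by
    rw [Fintype.sum_sigma]
    refine Finset.sum_congr rfl fun i _ => ?_
    simp_rw [Fintype.sum_sigma]
    rw [Finset.sum_comm]
    refine Finset.sum_congr rfl fun j _ => ?_
    simp_rw [hGG, Finset.mul_sum]
    have : ∀ k, bracketNormSq Q (e i) (e j) (e k) * x k / (x i * x j)
        = ∑ a, ∑ a', ∑ c, (x i)⁻¹ * ((x j)⁻¹ * (x k * Q ⁅e i a, e j a'⁆ (e k c) ^ 2)) := by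
      intro k
      unfold bracketNormSq
      rw [mul_div_assoc, Finset.sum_mul]
      refine Finset.sum_congr rfl fun a _ => ?_
      rw [Finset.sum_mul]
      refine Finset.sum_congr rfl fun a' _ => ?_
      rw [Finset.sum_mul]
      refine Finset.sum_congr rfl fun c _ => ?_
      rw [hcyc]
      field_simp
    simp_rw [this]
    rw [Finset.sum_comm (s := (Finset.univ : Finset (Fin s)))]
    refine Finset.sum_congr rfl fun a _ => ?_
    rw [Finset.sum_comm]
  rw [hA, hB, hC]
  ring
end

section
/- If h is the inner product on 𝔫 given by h = Σ_{i∈J} y_i π_{𝔪_i}*Q with y_i > 0 for i ∈ J, then Ŝ(h) = (1/2)·Σ_{i∈J} d_i b_i / y_i − (1/2)·Σ_{i∈J} Σ_{j,k∈Jᶜ} [ijk]/y_i − (1/4)·Σ_{i,j,k∈J} [ijk] · y_k/(y_i y_j), where Jᶜ is the complement of J in {1,…,s}. -/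
open scoped BigOperators

theorem aux_repr {V ι : Type*} [AddCommGroup V] [Module ℝ V] [DecidableEq ι]
    (H : V →ₗ[ℝ] V →ₗ[ℝ] ℝ) (u : ι → V) (S : Finset ι) (r : ι → ℝ)
    (hr : ∀ p ∈ S, r p ≠ 0)
    (hu : ∀ p ∈ S, ∀ q ∈ S, H (u p) (u q) = if p = q then r p else 0)
    (x : V) (hx : x ∈ Submodule.span ℝ (u '' (S : Set ι))) :
    x = ∑ p ∈ S, ((r p)⁻¹ * H x (u p)) • u p := by
  induction hx using Submodule.span_induction with
  | mem x hx =>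
    obtain ⟨q, hq, rfl⟩ := hx
    have hq' : q ∈ S := hq
    rw [Finset.sum_eq_single_of_mem q hq']
    · rw [hu q hq' q hq', if_pos rfl, inv_mul_cancel₀ (hr q hq'), one_smul]
    · intro p hp hpq
      rw [hu q hq' p hp, if_neg (Ne.symm hpq), mul_zero, zero_smul]
  | zero => simp
  | add x z _ _ h1 h2 =>
    conv_lhs => rw [h1, h2]
    rw [← Finset.sum_add_distrib]
    refine Finset.sum_congr rfl fun p _ => ?_
    rw [← add_smul, map_add, LinearMap.add_apply, mul_add]
  | smul c x _ h1 =>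
    conv_lhs => rw [h1]
    rw [Finset.smul_sum]
    refine Finset.sum_congr rfl fun p _ => ?_
    rw [smul_smul, map_smul, LinearMap.smul_apply, smul_eq_mul]
    congr 1
    ring

theorem aux_parseval {V ι : Type*} [AddCommGroup V] [Module ℝ V] [DecidableEq ι]
    (H : V →ₗ[ℝ] V →ₗ[ℝ] ℝ) (u : ι → V) (S : Finset ι) (r : ι → ℝ)
    (hr : ∀ p ∈ S, r p ≠ 0)
    (hu : ∀ p ∈ S, ∀ q ∈ S, H (u p) (u q) = if p = q then r p else 0)
    (x : V) (hx : x ∈ Submodule.span ℝ (u '' (S : Set ι))) :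
    H x x = ∑ p ∈ S, (r p)⁻¹ * (H x (u p)) ^ 2 := by
  have h1 := congrArg (H x) (aux_repr H u S r hr hu x hx)
  rw [h1, map_sum]
  refine Finset.sum_congr rfl fun p _ => ?_
  rw [map_smul, smul_eq_mul]
  ring

theorem aux_trace_s2 {V ι κ : Type*} [AddCommGroup V] [Module ℝ V] [DecidableEq ι] [DecidableEq κ]
    (H : V →ₗ[ℝ] V →ₗ[ℝ] ℝ) (hs : ∀ x z, H x z = H z x)
    (u : ι → V) (S : Finset ι) (r : ι → ℝ)
    (hr : ∀ p ∈ S, r p ≠ 0)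
    (hu : ∀ p ∈ S, ∀ q ∈ S, H (u p) (u q) = if p = q then r p else 0)
    (v : κ → V) (T : Finset κ) (t : κ → ℝ)
    (ht : ∀ p ∈ T, t p ≠ 0)
    (hv : ∀ p ∈ T, ∀ q ∈ T, H (v p) (v q) = if p = q then t p else 0)
    (huv : ∀ p ∈ S, u p ∈ Submodule.span ℝ (v '' (T : Set κ)))
    (hvu : ∀ p ∈ T, v p ∈ Submodule.span ℝ (u '' (S : Set ι)))
    (F : V →ₗ[ℝ] V →ₗ[ℝ] ℝ) :
    ∑ p ∈ S, (r p)⁻¹ * F (u p) (u p) = ∑ q ∈ T, (t q)⁻¹ * F (v q) (v q) := by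
  have h1 : ∀ p ∈ S, (r p)⁻¹ * F (u p) (u p)
      = ∑ q ∈ T, (r p)⁻¹ * ((t q)⁻¹ * H (u p) (v q) * F (u p) (v q)) := by
    intro p hp
    have := congrArg (F (u p)) (aux_repr H v T t ht hv (u p) (huv p hp))
    rw [this, map_sum, Finset.mul_sum]
    refine Finset.sum_congr rfl fun q _ => ?_
    rw [map_smul, smul_eq_mul]
  have h2 : ∀ q ∈ T, (t q)⁻¹ * F (v q) (v q)
      = ∑ p ∈ S, (r p)⁻¹ * ((t q)⁻¹ * H (u p) (v q) * F (u p) (v q)) := by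
    intro q hq
    have := congrArg (fun z => F z (v q)) (aux_repr H u S r hr hu (v q) (hvu q hq))
    rw [this, map_sum, LinearMap.sum_apply, Finset.mul_sum]
    refine Finset.sum_congr rfl fun p _ => ?_
    rw [map_smul, LinearMap.smul_apply, smul_eq_mul, hs (v q) (u p)]
    ring
  rw [Finset.sum_congr rfl h1, Finset.sum_congr rfl h2, Finset.sum_comm]

theorem aux_reorder {s : ℕ} (d : Fin s → ℕ) (I K L : Finset (Fin s))
    (f : (Σ i, Fin (d i)) → (Σ i, Fin (d i)) → (Σ i, Fin (d i)) → ℝ) :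
    ∑ p ∈ I.sigma (fun i => (Finset.univ : Finset (Fin (d i)))),
      ∑ q ∈ K.sigma (fun i => (Finset.univ : Finset (Fin (d i)))),
      ∑ r ∈ L.sigma (fun i => (Finset.univ : Finset (Fin (d i)))), f p q r
    = ∑ i ∈ I, ∑ j ∈ K, ∑ k ∈ L, ∑ a, ∑ b, ∑ c, f ⟨i, a⟩ ⟨j, b⟩ ⟨k, c⟩ := by
  simp only [Finset.sum_sigma]
  refine Finset.sum_congr rfl fun i _ => ?_
  rw [Finset.sum_comm]
  refine Finset.sum_congr rfl fun j _ => ?_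
  conv_rhs => rw [Finset.sum_comm]
  refine Finset.sum_congr rfl fun a _ => ?_
  conv_rhs => rw [Finset.sum_comm]

/-- If `h = Σ_{i∈J} yᵢ π_{𝔪ᵢ}* Q` with `yᵢ > 0`, then
`Ŝ(h) = (1/2)Σ_{i∈J} dᵢbᵢ/yᵢ − (1/2)Σ_{i∈J}Σ_{j,k∈Jᶜ}[ijk]/yᵢ − (1/4)Σ_{i,j,k∈J}[ijk]·y_k/(y_i y_j)`. -/
theorem stmt2 {𝔤 : Type*} [LieRing 𝔤] [LieAlgebra ℝ 𝔤] [FiniteDimensional ℝ 𝔤]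
    (Q : 𝔤 →ₗ[ℝ] 𝔤 →ₗ[ℝ] ℝ)
    (hQsymm : ∀ v w, Q v w = Q w v)
    (hQpos : ∀ v, v ≠ 0 → 0 < Q v v)
    (hQad : ∀ z v w : 𝔤, Q ⁅z, v⁆ w + Q v ⁅z, w⁆ = 0)
    -- the Lie subalgebra 𝔥 and the Q-orthogonal complement 𝔪 of 𝔥 in 𝔤
    (𝔥 : LieSubalgebra ℝ 𝔤) (𝔪 : Submodule ℝ 𝔤)
    (h𝔪 : ∀ v, v ∈ 𝔪 ↔ ∀ z ∈ 𝔥, Q v z = 0)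
    -- the Q-orthogonal decomposition 𝔪 = 𝔪₁ ⊕ ⋯ ⊕ 𝔪ₛ
    {s : ℕ} (msub : Fin s → Submodule ℝ 𝔤)
    (hsub : ∀ i, msub i ≤ 𝔪) (hnz : ∀ i, msub i ≠ ⊥)
    (horth : ∀ i j, i ≠ j → ∀ v ∈ msub i, ∀ w ∈ msub j, Q v w = 0)
    (hsup : (⨆ i, msub i) = 𝔪)
    -- Q-orthonormal bases of the summands, dᵢ = dim 𝔪ᵢ
    (d : Fin s → ℕ) (e : ∀ i, Fin (d i) → 𝔤)
    (he_mem : ∀ i a, e i a ∈ msub i)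
    (he_span : ∀ i, Submodule.span ℝ (Set.range (e i)) = msub i)
    (he_on : ∀ i a b, Q (e i a) (e i b) = if a = b then 1 else 0)
    -- B = −bᵢ Q on 𝔪ᵢ
    (b : Fin s → ℝ)
    (hb : ∀ i, ∀ v ∈ msub i, ∀ w ∈ msub i, killingForm ℝ 𝔤 v w = -(b i) * Q v w)
    -- Q-orthogonal projections πᵢ onto 𝔪ᵢ
    (π : Fin s → (𝔤 →ₗ[ℝ] 𝔤))
    (hπ_mem : ∀ i v, π i v ∈ msub i)
    (hπ_id : ∀ i, ∀ v ∈ msub i, π i v = v)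
    (hπ_orth : ∀ i v, ∀ w ∈ msub i, Q (v - π i v) w = 0)
    -- J ⊆ {1,…,s}, 𝔫 = ⊕_{i∈J} 𝔪ᵢ, 𝔩 = ⊕_{i∈Jᶜ} 𝔪ᵢ, and 𝔨 = 𝔫 ⊕ 𝔥 is a Lie subalgebra
    (J : Finset (Fin s)) (𝔫 𝔩 : Submodule ℝ 𝔤)
    (h𝔫 : 𝔫 = ⨆ i ∈ J, msub i)
    (h𝔩 : 𝔩 = ⨆ i ∈ Jᶜ, msub i)
    (h𝔨 : ∀ v w : 𝔤, v ∈ 𝔫 ⊔ 𝔥.toSubmodule → w ∈ 𝔫 ⊔ 𝔥.toSubmodule →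
      ⁅v, w⁆ ∈ 𝔫 ⊔ 𝔥.toSubmodule)
    -- Q-orthogonal projections onto 𝔫 and 𝔩
    (πn : 𝔤 →ₗ[ℝ] 𝔤)
    (hπn_mem : ∀ v, πn v ∈ 𝔫) (hπn_id : ∀ v ∈ 𝔫, πn v = v)
    (hπn_orth : ∀ v, ∀ w ∈ 𝔫, Q (v - πn v) w = 0)
    (πl : 𝔤 →ₗ[ℝ] 𝔤)
    (hπl_mem : ∀ v, πl v ∈ 𝔩) (hπl_id : ∀ v ∈ 𝔩, πl v = v)
    (hπl_orth : ∀ v, ∀ w ∈ 𝔩, Q (v - πl v) w = 0)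
    -- the inner product h = Σ_{i∈J} yᵢ π_{𝔪ᵢ}* Q on 𝔫, with yᵢ > 0
    (y : Fin s → ℝ) (hy : ∀ i ∈ J, 0 < y i)
    (h : 𝔤 → 𝔤 → ℝ)
    (hh : ∀ v w, h v w = ∑ i ∈ J, y i * Q (π i v) (π i w))
    -- an h-orthonormal basis of 𝔫
    {N : ℕ} (w : Fin N → 𝔤)
    (hw_mem : ∀ a, w a ∈ 𝔫)
    (hw_span : Submodule.span ℝ (Set.range w) = 𝔫)
    (hw_on : ∀ a b, h (w a) (w b) = if a = b then 1 else 0)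
    -- a Q-orthonormal basis of 𝔩
    {m : ℕ} (vb : Fin m → 𝔤)
    (hvb_mem : ∀ a, vb a ∈ 𝔩)
    (hvb_span : Submodule.span ℝ (Set.range vb) = 𝔩)
    (hvb_on : ∀ a b, Q (vb a) (vb b) = if a = b then 1 else 0) :
    -(1/2) * (∑ a, killingForm ℝ 𝔤 (w a) (w a))
        - (1/2) * (∑ a, ∑ b', Q (πl ⁅w a, vb b'⁆) (πl ⁅w a, vb b'⁆))
        - (1/4) * (∑ a, ∑ a', h (πn ⁅w a, w a'⁆) (πn ⁅w a, w a'⁆))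
      = (1/2) * (∑ i ∈ J, (d i : ℝ) * b i / y i)
        - (1/2) * (∑ i ∈ J, ∑ j ∈ Jᶜ, ∑ k ∈ Jᶜ, bracketNormSq Q (e i) (e j) (e k) / y i)
        - (1/4) * (∑ i ∈ J, ∑ j ∈ J, ∑ k ∈ J,
            bracketNormSq Q (e i) (e j) (e k) * y k / (y i * y j)) := by
  classical
  -- the combined family
  let E : (Σ i, Fin (d i)) → 𝔤 := fun p => e p.1 p.2
  let SS : Finset (Fin s) → Finset (Σ i, Fin (d i)) :=
    fun I => I.sigma (fun i => (Finset.univ : Finset (Fin (d i))))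
  have hSS : ∀ I p, p ∈ SS I ↔ p.1 ∈ I := by
    intro I p; simp [SS]
  have hEmem : ∀ p, E p ∈ msub p.1 := fun p => he_mem _ _
  have hEQ : ∀ p q, Q (E p) (E q) = if p = q then 1 else 0 := by
    rintro ⟨i, a⟩ ⟨j, c⟩
    by_cases hij : i = j
    · subst hij
      simp [E, he_on]
    · rw [horth i j hij _ (hEmem ⟨i, a⟩) _ (hEmem ⟨j, c⟩), if_neg]
      intro hc
      exact hij (congrArg Sigma.fst hc)
  have hspan : ∀ (I : Finset (Fin s)) x, x ∈ (⨆ i ∈ I, msub i) →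
      x ∈ Submodule.span ℝ (E '' (SS I : Set (Σ i, Fin (d i)))) := by
    intro I x hx
    have : (⨆ i ∈ I, msub i) ≤ Submodule.span ℝ (E '' (SS I : Set (Σ i, Fin (d i)))) := by
      refine iSup₂_le fun i hi => ?_
      rw [← he_span i]
      refine Submodule.span_mono ?_
      rintro _ ⟨a, rfl⟩
      exact ⟨⟨i, a⟩, (hSS I ⟨i, a⟩).2 hi, rfl⟩
    exact this hx
  have hEI : ∀ (I : Finset (Fin s)) p, p ∈ SS I → E p ∈ (⨆ i ∈ I, msub i) := by
    intro I p hp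
    have h1 : msub p.1 ≤ ⨆ i ∈ I, msub i := le_iSup₂_of_le p.1 ((hSS I p).1 hp) le_rfl
    exact h1 (hEmem p)
  -- projections
  have hπQ : ∀ i x z, z ∈ msub i → Q (π i x) z = Q x z := by
    intro i x z hz
    have := hπ_orth i x z hz
    rw [map_sub, LinearMap.sub_apply] at this
    linarith
  have hπ0 : ∀ i j, i ≠ j → ∀ z ∈ msub j, π i z = 0 := by
    intro i j hij z hz
    by_contra hne
    have h1 := hQpos _ hne
    rw [hπQ i z _ (hπ_mem i z), horth j i (Ne.symm hij) z hz _ (hπ_mem i z)] at h1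
    exact lt_irrefl _ h1
  -- the bilinear form
  let H : 𝔤 →ₗ[ℝ] 𝔤 →ₗ[ℝ] ℝ := ∑ i ∈ J, y i • Q.compl₁₂ (π i) (π i)
  have hH : ∀ x z, H x z = h x z := by
    intro x z
    rw [hh]
    simp [H, LinearMap.sum_apply]
  have hHs : ∀ x z, H x z = H z x := by
    intro x z
    rw [hH, hH, hh, hh]
    exact Finset.sum_congr rfl fun i _ => by rw [hQsymm]
  have hHE : ∀ p ∈ SS J, ∀ q ∈ SS J, H (E p) (E q) = if p = q then y p.1 else 0 := by
    intro p hp q hq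
    rw [hH, hh, Finset.sum_eq_single_of_mem p.1 ((hSS J p).1 hp)]
    · rw [hπ_id _ _ (hEmem p), hQsymm, hπQ _ _ _ (hEmem p), hQsymm, hEQ]
      split_ifs <;> simp
    · intro i _ hi
      rw [hπ0 i p.1 hi _ (hEmem p)]
      simp
  have hyne : ∀ p ∈ SS J, y p.1 ≠ 0 := fun p hp => (hy _ ((hSS J p).1 hp)).ne'
  -- trace lemma for 𝔫
  have htr_n : ∀ F : 𝔤 →ₗ[ℝ] 𝔤 →ₗ[ℝ] ℝ,
      ∑ a, F (w a) (w a) = ∑ p ∈ SS J, (y p.1)⁻¹ * F (E p) (E p) := by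
    intro F
    have := aux_trace_s2 H hHs w Finset.univ (fun _ => 1) (by simp)
      (by intro p _ q _; rw [hH, hw_on]) E (SS J) (fun p => y p.1) hyne hHE
      (by intro a _; exact hspan J _ (h𝔫 ▸ hw_mem a))
      (by
        intro p hp
        have h1 := hEI J p hp
        rw [← h𝔫, ← hw_span] at h1
        simpa using h1) F
    simpa using this
  have htr_l : ∀ F : 𝔤 →ₗ[ℝ] 𝔤 →ₗ[ℝ] ℝ,
      ∑ a, F (vb a) (vb a) = ∑ p ∈ SS Jᶜ, F (E p) (E p) := by
    intro F
    have := aux_trace_s2 Q hQsymm vb Finset.univ (fun _ => 1) (by simp)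
      (by intro p _ q _; rw [hvb_on]) E (SS Jᶜ) (fun _ => 1) (by simp)
      (by intro p _ q _; rw [hEQ])
      (by intro a _; exact hspan Jᶜ _ (h𝔩 ▸ hvb_mem a))
      (by
        intro p hp
        have h1 := hEI Jᶜ p hp
        rw [← h𝔩, ← hvb_span] at h1
        simpa using h1) F
    simpa using this
  -- Parseval
  have hpl : ∀ x, Q (πl x) (πl x) = ∑ r ∈ SS Jᶜ, (Q x (E r)) ^ 2 := by
    intro x
    have h1 := aux_parseval Q E (SS Jᶜ) (fun _ => 1) (by simp)
      (by intro p _ q _; rw [hEQ]) (πl x) (hspan Jᶜ _ (h𝔩 ▸ hπl_mem x))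
    rw [h1]
    refine Finset.sum_congr rfl fun r hr => ?_
    have h2 := hπl_orth x (E r) (by rw [h𝔩]; exact hEI Jᶜ r hr)
    rw [map_sub, LinearMap.sub_apply] at h2
    rw [inv_one, one_mul, sub_eq_zero.1 h2]
  have hpn : ∀ x, H (πn x) (πn x) = ∑ r ∈ SS J, y r.1 * (Q x (E r)) ^ 2 := by
    intro x
    have h1 := aux_parseval H E (SS J) (fun p => y p.1) hyne hHE (πn x)
      (hspan J _ (h𝔫 ▸ hπn_mem x))
    rw [h1]
    refine Finset.sum_congr rfl fun r hr => ?_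
    have h2 := hπn_orth x (E r) (by rw [h𝔫]; exact hEI J r hr)
    rw [map_sub, LinearMap.sub_apply] at h2
    have h3 : H (πn x) (E r) = y r.1 * Q x (E r) := by
      rw [hH, hh, Finset.sum_eq_single_of_mem r.1 ((hSS J r).1 hr)]
      · rw [hπ_id _ _ (hEmem r), hπQ _ _ _ (hEmem r), sub_eq_zero.1 h2]
      · intro i _ hi
        rw [hπ0 i r.1 hi _ (hEmem r)]
        simp
    rw [h3]
    have := hyne r hr
    field_simp
  -- cyclic symmetry
  have hcyc : ∀ x z t : 𝔤, Q ⁅x, z⁆ t = Q ⁅z, t⁆ x := by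
    intro x z t
    have h1 := hQad z x t
    rw [hQsymm x, ← lie_skew z x, map_neg, LinearMap.neg_apply] at h1
    linarith
  -- bilinear forms
  let BF : (𝔤 →ₗ[ℝ] 𝔤 →ₗ[ℝ] ℝ) → (𝔤 →ₗ[ℝ] 𝔤) → 𝔤 → (𝔤 →ₗ[ℝ] 𝔤 →ₗ[ℝ] ℝ) :=
    fun G P z => LinearMap.mk₂ ℝ (fun x x' => G (P ⁅x, z⁆) (P ⁅x', z⁆))
      (by intros; simp) (by intros; simp) (by intros; simp) (by intros; simp)
  let BF' : (𝔤 →ₗ[ℝ] 𝔤 →ₗ[ℝ] ℝ) → (𝔤 →ₗ[ℝ] 𝔤) → 𝔤 → (𝔤 →ₗ[ℝ] 𝔤 →ₗ[ℝ] ℝ) :=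
    fun G P z => LinearMap.mk₂ ℝ (fun x x' => G (P ⁅z, x⁆) (P ⁅z, x'⁆))
      (by intros; simp) (by intros; simp) (by intros; simp) (by intros; simp)
  have hBF : ∀ G P z x, BF G P z x x = G (P ⁅x, z⁆) (P ⁅x, z⁆) := fun _ _ _ _ => rfl
  have hBF' : ∀ G P z x, BF' G P z x x = G (P ⁅z, x⁆) (P ⁅z, x⁆) := fun _ _ _ _ => rfl
  -- term 1
  have T1 : ∑ a, killingForm ℝ 𝔤 (w a) (w a) = - ∑ i ∈ J, (d i : ℝ) * b i / y i := by
    rw [htr_n (killingForm ℝ 𝔤), Finset.sum_sigma, ← Finset.sum_neg_distrib]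
    refine Finset.sum_congr rfl fun i _ => ?_
    have : ∀ a : Fin (d i), (y i)⁻¹ * killingForm ℝ 𝔤 (E ⟨i, a⟩) (E ⟨i, a⟩)
        = (y i)⁻¹ * -(b i) := by
      intro a
      rw [hb i _ (hEmem ⟨i, a⟩) _ (hEmem ⟨i, a⟩), hEQ, if_pos rfl, mul_one]
    rw [Finset.sum_congr rfl fun a _ => this a]
    simp
    ring
  -- term 2
  have T2 : ∑ a, ∑ b', Q (πl ⁅w a, vb b'⁆) (πl ⁅w a, vb b'⁆)
      = ∑ i ∈ J, ∑ j ∈ Jᶜ, ∑ k ∈ Jᶜ, bracketNormSq Q (e i) (e j) (e k) / y i := by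
    have s1 : ∀ a, ∑ b', Q (πl ⁅w a, vb b'⁆) (πl ⁅w a, vb b'⁆)
        = ∑ q ∈ SS Jᶜ, Q (πl ⁅w a, E q⁆) (πl ⁅w a, E q⁆) := fun a => htr_l (BF' Q πl (w a))
    have s2 : ∀ z, ∑ a, Q (πl ⁅w a, z⁆) (πl ⁅w a, z⁆)
        = ∑ p ∈ SS J, (y p.1)⁻¹ * Q (πl ⁅E p, z⁆) (πl ⁅E p, z⁆) := fun z => htr_n (BF Q πl z)
    rw [Finset.sum_congr rfl fun a _ => s1 a, Finset.sum_comm,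
      Finset.sum_congr rfl fun q _ => s2 (E q), Finset.sum_comm]
    simp only [hpl, Finset.mul_sum]
    rw [aux_reorder d J Jᶜ Jᶜ (fun p q r => (y p.1)⁻¹ * Q ⁅E p, E q⁆ (E r) ^ 2)]
    simp only [bracketNormSq, Finset.sum_div]
    refine Finset.sum_congr rfl fun i _ => Finset.sum_congr rfl fun j _ =>
      Finset.sum_congr rfl fun k _ => Finset.sum_congr rfl fun a _ =>
      Finset.sum_congr rfl fun c _ => Finset.sum_congr rfl fun c' _ => ?_
    rw [hcyc]
    simp only [E]
    ring
  -- term 3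
  have T3 : ∑ a, ∑ a', h (πn ⁅w a, w a'⁆) (πn ⁅w a, w a'⁆)
      = ∑ i ∈ J, ∑ j ∈ J, ∑ k ∈ J,
            bracketNormSq Q (e i) (e j) (e k) * y k / (y i * y j) := by
    simp only [← hH]
    have s1 : ∀ a, ∑ b', H (πn ⁅w a, w b'⁆) (πn ⁅w a, w b'⁆)
        = ∑ q ∈ SS J, (y q.1)⁻¹ * H (πn ⁅w a, E q⁆) (πn ⁅w a, E q⁆) :=
      fun a => htr_n (BF' H πn (w a))
    have s2 : ∀ z, ∑ a, H (πn ⁅w a, z⁆) (πn ⁅w a, z⁆)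
        = ∑ p ∈ SS J, (y p.1)⁻¹ * H (πn ⁅E p, z⁆) (πn ⁅E p, z⁆) := fun z => htr_n (BF H πn z)
    rw [Finset.sum_congr rfl fun a _ => s1 a, Finset.sum_comm]
    have s3 : ∀ q ∈ SS J, ∑ a, (y q.1)⁻¹ * H (πn ⁅w a, E q⁆) (πn ⁅w a, E q⁆)
        = ∑ p ∈ SS J, (y q.1)⁻¹ * ((y p.1)⁻¹ * H (πn ⁅E p, E q⁆) (πn ⁅E p, E q⁆)) := by
      intro q _
      rw [← Finset.mul_sum, s2, Finset.mul_sum]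
    rw [Finset.sum_congr rfl s3, Finset.sum_comm]
    simp only [hpn, Finset.mul_sum]
    rw [aux_reorder d J J J
      (fun p q r => (y q.1)⁻¹ * ((y p.1)⁻¹ * (y r.1 * Q ⁅E p, E q⁆ (E r) ^ 2)))]
    simp only [bracketNormSq, Finset.sum_div, Finset.sum_mul]
    refine Finset.sum_congr rfl fun i _ => Finset.sum_congr rfl fun j _ =>
      Finset.sum_congr rfl fun k _ => Finset.sum_congr rfl fun a _ =>
      Finset.sum_congr rfl fun c _ => Finset.sum_congr rfl fun c' _ => ?_
    rw [hcyc, div_eq_mul_inv, mul_inv]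
    simp only [E]
    ring
  rw [T1, T2, T3]
  ring
end

section
/- Let 𝔨 be a Lie subalgebra of 𝔤 and let 𝔩 be the Q-orthogonal complement of 𝔨 in 𝔤. Then −2·tr_Q B|_𝔩 − ⟨𝔩𝔩𝔩⟩ ≥ 0, where tr_Q B|_𝔩 = Σ_a B(e_a,e_a) for a Q-orthonormal basis {e_a} of 𝔩 and B is the Killing form of 𝔤. -/
open scoped BigOperators

theorem aux_skew {E : Type*} [NormedAddCommGroup E] [InnerProductSpace ℝ E]
    [FiniteDimensional ℝ E] (T : E →ₗ[ℝ] E) (hT : ∀ v w, inner ℝ (T v) w + inner ℝ v (T w) = 0)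
    {m : ℕ} (e : Fin m → E) (he : Orthonormal ℝ e) :
    ∑ c, ∑ d, (inner ℝ (T (e c)) (e d)) ^ 2 ≤ - LinearMap.trace ℝ E (T ∘ₗ T) := by
  classical
  obtain ⟨u, b, hu, hb⟩ := he.toSubtypeRange.exists_orthonormalBasis_extension
  rw [LinearMap.trace_eq_sum_inner _ b]
  have h1 : ∀ i, inner ℝ (b i) ((T ∘ₗ T) (b i)) = - ‖T (i : E)‖ ^ 2 := by
    intro i
    have := hT (b i) (T (b i))
    rw [real_inner_self_eq_norm_sq] at this
    simp only [LinearMap.comp_apply, hb] at this ⊢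
    linarith
  simp only [h1, Finset.sum_neg_distrib, neg_neg]
  rw [Finset.sum_coe_sort u (fun x => ‖T x‖ ^ 2)]
  calc ∑ c, ∑ d, (inner ℝ (T (e c)) (e d)) ^ 2 ≤ ∑ c, ‖T (e c)‖ ^ 2 := by
        refine Finset.sum_le_sum fun c _ => ?_
        have := he.sum_inner_products_le (T (e c)) (s := Finset.univ)
        refine le_trans (le_of_eq ?_) this
        refine Finset.sum_congr rfl fun d _ => ?_
        rw [real_inner_comm, Real.norm_eq_abs, sq_abs]
    _ = ∑ x ∈ Finset.univ.image e, ‖T x‖ ^ 2 := by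
        rw [Finset.sum_image fun x _ y _ h => he.linearIndependent.injective h]
    _ ≤ _ := by
        refine Finset.sum_le_sum_of_subset_of_nonneg ?_ fun _ _ _ => by positivity
        intro x hx
        obtain ⟨c, -, rfl⟩ := Finset.mem_image.1 hx
        exact hu ⟨c, rfl⟩

/-- If 𝔨 is a Lie subalgebra of 𝔤 and 𝔩 its Q-orthogonal complement, then
`−2·tr_Q B|𝔩 − ⟨𝔩𝔩𝔩⟩ ≥ 0`. -/
theorem stmt3 {𝔤 : Type*} [LieRing 𝔤] [LieAlgebra ℝ 𝔤] [FiniteDimensional ℝ 𝔤]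
    (Q : 𝔤 →ₗ[ℝ] 𝔤 →ₗ[ℝ] ℝ)
    (hQsymm : ∀ v w, Q v w = Q w v)
    (hQpos : ∀ v, v ≠ 0 → 0 < Q v v)
    (hQad : ∀ z v w : 𝔤, Q ⁅z, v⁆ w + Q v ⁅z, w⁆ = 0)
    (𝔨 : LieSubalgebra ℝ 𝔤) (𝔩 : Submodule ℝ 𝔤)
    (h𝔩 : ∀ v, v ∈ 𝔩 ↔ ∀ z ∈ 𝔨, Q v z = 0)
    {m : ℕ} (e : Fin m → 𝔤)
    (he_mem : ∀ a, e a ∈ 𝔩)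
    (he_span : Submodule.span ℝ (Set.range e) = 𝔩)
    (he_on : ∀ a b, Q (e a) (e b) = if a = b then 1 else 0) :
    0 ≤ -2 * (∑ a, killingForm ℝ 𝔤 (e a) (e a)) - bracketNormSq Q e e e := by
  let core : InnerProductSpace.Core ℝ 𝔤 :=
    { inner := fun v w => Q v w
      conj_inner_symm := fun v w => by simpa using hQsymm w v
      re_inner_nonneg := fun v => by
        by_cases h : v = 0
        · simp [h]
        · simpa using (hQpos v h).le
      add_left := fun x y z => by simp
      smul_left := fun x y r => by simp
      definite := fun v h => by
        by_contra h0
        exact (hQpos v h0).ne' h }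
  have key : ∀ a, ∑ c, ∑ d, (Q ⁅e a, e c⁆ (e d)) ^ 2 ≤ - killingForm ℝ 𝔤 (e a) (e a) := by
    intro a
    letI : NormedAddCommGroup 𝔤 := core.toNormedAddCommGroup
    letI : InnerProductSpace ℝ 𝔤 := InnerProductSpace.ofCore core.toCore
    have he : Orthonormal ℝ e := orthonormal_iff_ite.2 he_on
    exact aux_skew (LieAlgebra.ad ℝ 𝔤 (e a)) (fun v w => hQad (e a) v w) e he
  have h2 := Finset.sum_le_sum fun a (_ : a ∈ Finset.univ) => key a
  have h3 : bracketNormSq Q e e e = ∑ a, ∑ c, ∑ d, (Q ⁅e a, e c⁆ (e d)) ^ 2 := by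
    unfold bracketNormSq
    rw [Finset.sum_comm]
    exact Finset.sum_congr rfl fun _ _ => Finset.sum_comm
  have h4 : 0 ≤ bracketNormSq Q e e e := by
    unfold bracketNormSq
    positivity
  rw [← h3, Finset.sum_neg_distrib] at h2
  linarith
end

section
/- The quantity σ(𝔨,T) = sup{ Ŝ(h) : h ∈ 𝓜_T(𝔨) } satisfies 0 ≤ σ(𝔨,T) < ∞. -/
open scoped BigOperators


section aux
open scoped InnerProductSpace

theorem aux_trace_s4 {E : Type*} [NormedAddCommGroup E] [InnerProductSpace ℝ E]
    [FiniteDimensional ℝ E] (A : E →ₗ[ℝ] E) (hA : ∀ x, 0 ≤ ⟪x, A x⟫_ℝ)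
    {ι : Type*} [Fintype ι] (v : ι → E) (hv : Orthonormal ℝ v) :
    ∑ i, ⟪v i, A (v i)⟫_ℝ ≤ LinearMap.trace ℝ E A := by
  classical
  obtain ⟨u, b, hu, hb⟩ := hv.toSubtypeRange.exists_orthonormalBasis_extension
  rw [LinearMap.trace_eq_sum_inner A b]
  rw [hb]
  rw [Finset.sum_coe_sort u (fun x => ⟪x, A x⟫_ℝ)]
  rw [← Finset.sum_image (f := fun x => ⟪x, A x⟫_ℝ) (s := Finset.univ) (g := v)
    (fun i _ j _ h => hv.linearIndependent.injective h)]
  apply Finset.sum_le_sum_of_subset_of_nonneg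
  · intro x hx
    simp only [Finset.mem_image, Finset.mem_univ, true_and] at hx
    obtain ⟨i, rfl⟩ := hx
    exact hu ⟨i, rfl⟩
  · intro x _ _
    exact hA x

theorem aux_bdd {E : Type*} [NormedAddCommGroup E] [InnerProductSpace ℝ E]
    [FiniteDimensional ℝ E] (B : E →ₗ[ℝ] E →ₗ[ℝ] ℝ) :
    ∃ C : ℝ, ∀ x, |B x x| ≤ C * ⟪x, x⟫_ℝ := by
  refine ⟨‖B.toContinuousBilinearMap‖, fun x => ?_⟩
  have := B.toContinuousBilinearMap.le_opNorm₂ x x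
  rw [real_inner_self_eq_norm_sq]
  calc |B x x| ≤ _ := this
    _ = _ := by ring

/-- inner product core of a positive form -/
@[reducible] def auxCore {E : Type*} [AddCommGroup E] [Module ℝ E] (Q : E →ₗ[ℝ] E →ₗ[ℝ] ℝ)
    (hs : ∀ v w, Q v w = Q w v) (hp : ∀ v, v ≠ 0 → 0 < Q v v) :
    InnerProductSpace.Core ℝ E where
  inner x y := Q x y
  conj_inner_symm x y := by simpa using hs y x
  re_inner_nonneg x := by
    by_cases h : x = 0
    · simp [h]
    · simpa using (hp x h).le
  add_left x y z := by simp
  smul_left x y r := by simp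
  definite x h := by
    by_contra h0
    exact (hp x h0).ne' h

theorem aux_trace' {E : Type*} [AddCommGroup E] [Module ℝ E] [FiniteDimensional ℝ E]
    (Q : E →ₗ[ℝ] E →ₗ[ℝ] ℝ)
    (hs : ∀ v w, Q v w = Q w v) (hp : ∀ v, v ≠ 0 → 0 < Q v v)
    (A : E →ₗ[ℝ] E) (hA : ∀ x, 0 ≤ Q x (A x))
    {ι : Type*} [Fintype ι] [DecidableEq ι] (v : ι → E)
    (hv : ∀ i j, Q (v i) (v j) = if i = j then 1 else 0) :
    ∑ i, Q (v i) (A (v i)) ≤ LinearMap.trace ℝ E A := by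
  letI c := auxCore Q hs hp
  letI : NormedAddCommGroup E := c.toNormedAddCommGroup
  letI : InnerProductSpace ℝ E := InnerProductSpace.ofCore c.toCore
  exact aux_trace_s4 A hA v (orthonormal_iff_ite.2 hv)

theorem aux_bdd' {E : Type*} [AddCommGroup E] [Module ℝ E] [FiniteDimensional ℝ E]
    (Q : E →ₗ[ℝ] E →ₗ[ℝ] ℝ)
    (hs : ∀ v w, Q v w = Q w v) (hp : ∀ v, v ≠ 0 → 0 < Q v v)
    (B : E →ₗ[ℝ] E →ₗ[ℝ] ℝ) :
    ∃ C : ℝ, ∀ x, |B x x| ≤ C * Q x x := by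
  letI c := auxCore Q hs hp
  letI : NormedAddCommGroup E := c.toNormedAddCommGroup
  letI : InnerProductSpace ℝ E := InnerProductSpace.ofCore c.toCore
  exact aux_bdd B

theorem aux_basis {E : Type*} [AddCommGroup E] [Module ℝ E] [FiniteDimensional ℝ E]
    (Q : E →ₗ[ℝ] E →ₗ[ℝ] ℝ)
    (hs : ∀ v w, Q v w = Q w v) (hp : ∀ v, v ≠ 0 → 0 < Q v v)
    (n : Submodule ℝ E) :
    ∃ (N : ℕ) (e : Fin N → E), (∀ a, e a ∈ n) ∧ Submodule.span ℝ (Set.range e) = n ∧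
      ∀ a b, Q (e a) (e b) = if a = b then 1 else 0 := by
  letI c := auxCore Q hs hp
  letI : NormedAddCommGroup E := c.toNormedAddCommGroup
  letI : InnerProductSpace ℝ E := InnerProductSpace.ofCore c.toCore
  let b := stdOrthonormalBasis ℝ n
  refine ⟨_, fun a => (b a : E), fun a => (b a).2, ?_, ?_⟩
  · have h1 : Set.range (fun a => (b a : E)) = n.subtype '' Set.range b := by
      rw [← Set.range_comp]; rfl
    rw [h1, Submodule.span_image, ← OrthonormalBasis.coe_toBasis, b.toBasis.span_eq]
    simp
  · exact orthonormal_iff_ite.1 b.orthonormal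

theorem aux_ne {E : Type*} [AddCommGroup E] [Module ℝ E] [FiniteDimensional ℝ E]
    (Q : E →ₗ[ℝ] E →ₗ[ℝ] ℝ)
    (hs : ∀ v w, Q v w = Q w v) (hp : ∀ v, v ≠ 0 → 0 < Q v v)
    (H K : Submodule ℝ E) (hHK : H ≤ K) (hne : H ≠ K) :
    ∃ v ∈ K, (∀ z ∈ H, Q v z = 0) ∧ v ≠ 0 := by
  letI c := auxCore Q hs hp
  letI : NormedAddCommGroup E := c.toNormedAddCommGroup
  letI : InnerProductSpace ℝ E := InnerProductSpace.ofCore c.toCore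
  by_contra! hcon
  have h1 := Submodule.sup_orthogonal_inf_of_hasOrthogonalProjection hHK
  have h2 : Hᗮ ⊓ K = ⊥ := by
    rw [eq_bot_iff]
    rintro x ⟨hx1, hx2⟩
    exact hcon x hx2 (fun z hz => (Submodule.mem_orthogonal' H x).1 hx1 z hz)
  rw [h2, sup_bot_eq] at h1
  exact hne h1

theorem aux_proj {E : Type*} [AddCommGroup E] [Module ℝ E]
    (Q : E →ₗ[ℝ] E →ₗ[ℝ] ℝ)
    (hs : ∀ v w, Q v w = Q w v) (hp : ∀ v, v ≠ 0 → 0 < Q v v)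
    (x p : E) (h : Q (x - p) p = 0) : Q p p ≤ Q x x := by
  have h0 : 0 ≤ Q (x - p) (x - p) := by
    by_cases h : x - p = 0
    · simp [h]
    · exact (hp _ h).le
  have h1 := hs x p
  simp only [map_sub, LinearMap.sub_apply] at h h0
  linarith

end aux

/-- `0 ≤ σ(𝔨,T) < ∞`, where `σ(𝔨,T) = sup { Ŝ(h) : h ∈ 𝓜_T(𝔨) }`. -/
theorem stmt4 {𝔤 : Type*} [LieRing 𝔤] [LieAlgebra ℝ 𝔤] [FiniteDimensional ℝ 𝔤]
    (Q : 𝔤 →ₗ[ℝ] 𝔤 →ₗ[ℝ] ℝ)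
    (hQsymm : ∀ v w, Q v w = Q w v)
    (hQpos : ∀ v, v ≠ 0 → 0 < Q v v)
    (hQad : ∀ z v w : 𝔤, Q ⁅z, v⁆ w + Q v ⁅z, w⁆ = 0)
    -- Lie subalgebras 𝔥 ⊆ 𝔨 with 𝔥 ≠ 𝔨
    (𝔥 𝔨 : LieSubalgebra ℝ 𝔤) (h𝔥𝔨 : 𝔥 ≤ 𝔨) (h𝔥ne : 𝔥 ≠ 𝔨)
    -- 𝔫 = Q-orthogonal complement of 𝔥 in 𝔨, 𝔩 = Q-orthogonal complement of 𝔨 in 𝔤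
    (𝔫 𝔩 : Submodule ℝ 𝔤)
    (h𝔫 : ∀ v, v ∈ 𝔫 ↔ v ∈ 𝔨 ∧ ∀ z ∈ 𝔥, Q v z = 0)
    (h𝔩 : ∀ v, v ∈ 𝔩 ↔ ∀ z ∈ 𝔨, Q v z = 0)
    -- T : an ad(𝔥)-invariant positive-definite symmetric bilinear form on 𝔫
    (T : 𝔤 →ₗ[ℝ] 𝔤 →ₗ[ℝ] ℝ)
    (hTsymm : ∀ v w, T v w = T w v)
    (hTpos : ∀ v ∈ 𝔫, v ≠ 0 → 0 < T v v)
    (hTinv : ∀ z ∈ 𝔥, ∀ v ∈ 𝔫, ∀ w ∈ 𝔫, T ⁅z, v⁆ w + T v ⁅z, w⁆ = 0)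
    -- Q-orthogonal projections onto 𝔫 and 𝔩
    (πn : 𝔤 →ₗ[ℝ] 𝔤)
    (hπn_mem : ∀ v, πn v ∈ 𝔫) (hπn_id : ∀ v ∈ 𝔫, πn v = v)
    (hπn_orth : ∀ v, ∀ w ∈ 𝔫, Q (v - πn v) w = 0)
    (πl : 𝔤 →ₗ[ℝ] 𝔤)
    (hπl_mem : ∀ v, πl v ∈ 𝔩) (hπl_id : ∀ v ∈ 𝔩, πl v = v)
    (hπl_orth : ∀ v, ∀ w ∈ 𝔩, Q (v - πl v) w = 0)
    -- a Q-orthonormal basis of 𝔩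
    {m : ℕ} (vb : Fin m → 𝔤)
    (hvb_mem : ∀ a, vb a ∈ 𝔩)
    (hvb_span : Submodule.span ℝ (Set.range vb) = 𝔩)
    (hvb_on : ∀ a b, Q (vb a) (vb b) = if a = b then 1 else 0)
    -- S = { Ŝ(h) : h ∈ 𝓜_T(𝔨) }, each Ŝ(h) computed from an h-orthonormal basis of 𝔫
    (S : Set ℝ)
    (hS : ∀ r : ℝ, r ∈ S ↔
      ∃ (h : 𝔤 →ₗ[ℝ] 𝔤 →ₗ[ℝ] ℝ) (N : ℕ) (w : Fin N → 𝔤),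
        (∀ v w', h v w' = h w' v) ∧
        (∀ v ∈ 𝔫, v ≠ 0 → 0 < h v v) ∧
        (∀ z ∈ 𝔥, ∀ v ∈ 𝔫, ∀ w' ∈ 𝔫, h ⁅z, v⁆ w' + h v ⁅z, w'⁆ = 0) ∧
        (∀ a, w a ∈ 𝔫) ∧
        Submodule.span ℝ (Set.range w) = 𝔫 ∧
        (∀ a b, h (w a) (w b) = if a = b then 1 else 0) ∧
        (∑ a, T (w a) (w a)) = 1 ∧
        r = -(1/2) * (∑ a, killingForm ℝ 𝔤 (w a) (w a))
            - (1/2) * (∑ a, ∑ b', Q (πl ⁅w a, vb b'⁆) (πl ⁅w a, vb b'⁆))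
            - (1/4) * (∑ a, ∑ a', h (πn ⁅w a, w a'⁆) (πn ⁅w a, w a'⁆))) :
    0 ≤ sSup S ∧ BddAbove S := by
  have hQnn : ∀ v, 0 ≤ Q v v := fun v => by
    by_cases h : v = 0
    · simp [h]
    · exact (hQpos _ h).le
  have hbdd : BddAbove S := by
    obtain ⟨C, hC⟩ := aux_bdd' (T.domRestrict₁₂ 𝔫 𝔫) (fun v w => hTsymm v w)
      (fun v hv => hTpos v v.2 (fun h => hv (Subtype.ext h)))
      ((killingForm ℝ 𝔤).domRestrict₁₂ 𝔫 𝔫)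
    refine ⟨(1/2) * C, fun r hr => ?_⟩
    obtain ⟨h, N, w, hsym, hpos, -, hw, -, -, htr, rfl⟩ := (hS r).1 hr
    have hnn : ∀ v ∈ 𝔫, 0 ≤ h v v := fun v hv => by
      by_cases h0 : v = 0
      · simp [h0]
      · exact (hpos _ hv h0).le
    have h1 : -(∑ a, killingForm ℝ 𝔤 (w a) (w a)) ≤ C := by
      calc -(∑ a, killingForm ℝ 𝔤 (w a) (w a)) = ∑ a, -(killingForm ℝ 𝔤 (w a) (w a)) := by
            rw [Finset.sum_neg_distrib]
        _ ≤ ∑ a, C * T (w a) (w a) := Finset.sum_le_sum fun a _ =>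
            (neg_le_abs _).trans (hC ⟨w a, hw a⟩)
        _ = C := by rw [← Finset.mul_sum, htr, mul_one]
    have h2 : 0 ≤ ∑ a, ∑ b', Q (πl ⁅w a, vb b'⁆) (πl ⁅w a, vb b'⁆) :=
      Finset.sum_nonneg fun a _ => Finset.sum_nonneg fun b _ => hQnn _
    have h3 : 0 ≤ ∑ a, ∑ a', h (πn ⁅w a, w a'⁆) (πn ⁅w a, w a'⁆) :=
      Finset.sum_nonneg fun a _ => Finset.sum_nonneg fun b _ => hnn _ (hπn_mem _)
    linarith
  refine ⟨?_, hbdd⟩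
  obtain ⟨N, e, he, hespan, heo⟩ := aux_basis Q hQsymm hQpos 𝔫
  have hene : ∀ a, e a ≠ 0 := fun a h0 => by
    have := heo a a
    simp [h0] at this
  have hTe : ∀ a, 0 < T (e a) (e a) := fun a => hTpos _ (he a) (hene a)
  set c := ∑ a, T (e a) (e a) with hc
  have hcpos : 0 < c := by
    apply Finset.sum_pos (fun a _ => hTe a)
    by_contra hem
    rw [Finset.not_nonempty_iff_eq_empty, Finset.univ_eq_empty_iff] at hem
    rw [Set.range_eq_empty, Submodule.span_empty] at hespan
    obtain ⟨v, hvk, hvh, hv0⟩ := aux_ne Q hQsymm hQpos 𝔥.toSubmodule 𝔨.toSubmodule h𝔥𝔨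
      (fun h => h𝔥ne (LieSubalgebra.toSubmodule_injective h))
    have : v ∈ 𝔫 := (h𝔫 v).2 ⟨hvk, hvh⟩
    rw [← hespan] at this
    exact hv0 this
  set s := (Real.sqrt c)⁻¹ with hsdef
  have hs2 : s * s = c⁻¹ := by
    rw [hsdef, ← mul_inv, Real.mul_self_sqrt hcpos.le]
  have hs0 : s ≠ 0 := by
    intro h
    rw [h] at hs2
    simp at hs2
    exact hcpos.ne hs2
  have hcs : c * (s * s) = 1 := by rw [hs2]; exact mul_inv_cancel₀ hcpos.ne'
  -- Killing form estimate
  have hB : ∀ x, ∑ b, Q (πl ⁅x, vb b⁆) (πl ⁅x, vb b⁆) +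
      ∑ a, Q (πn ⁅x, e a⁆) (πn ⁅x, e a⁆) ≤ - killingForm ℝ 𝔤 x x := by
    intro x
    have hQA : ∀ y, Q y ((-(LieAlgebra.ad ℝ 𝔤 x ∘ₗ LieAlgebra.ad ℝ 𝔤 x)) y)
        = Q ⁅x, y⁆ ⁅x, y⁆ := fun y => by
      have := hQad x y ⁅x, y⁆
      simp only [LinearMap.neg_apply, LinearMap.comp_apply, LieAlgebra.ad_apply, map_neg]
      linarith
    have hln : ∀ b a, Q (vb b) (e a) = 0 := fun b a =>
      (h𝔩 _).1 (hvb_mem b) _ ((h𝔫 _).1 (he a)).1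
    have key := aux_trace' Q hQsymm hQpos (-(LieAlgebra.ad ℝ 𝔤 x ∘ₗ LieAlgebra.ad ℝ 𝔤 x))
      (fun y => by rw [hQA]; exact hQnn _) (Sum.elim vb e) (by
        rintro (i | i) (j | j)
        · simp [hvb_on]
        · simp [hln]
        · simp [hQsymm (e i), hln]
        · simp [heo])
    simp only [hQA, Fintype.sum_sum_type, Sum.elim_inl, Sum.elim_inr, map_neg] at key
    rw [killingForm_apply_apply]
    refine le_trans (add_le_add ?_ ?_) key
    · exact Finset.sum_le_sum fun b _ => aux_proj Q hQsymm hQpos _ _ (hπl_orth _ _ (hπl_mem _))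
    · exact Finset.sum_le_sum fun b _ => aux_proj Q hQsymm hQpos _ _ (hπn_orth _ _ (hπn_mem _))
  refine le_trans ?_ (le_csSup hbdd ((hS _).2 ⟨c • Q, N, fun a => s • e a, ?_, ?_, ?_, ?_, ?_, ?_,
    ?_, rfl⟩))
  · have hsum := Finset.sum_le_sum fun (a : Fin N) (_ : a ∈ Finset.univ) => hB (e a)
    rw [Finset.sum_add_distrib, Finset.sum_neg_distrib] at hsum
    have h3 : 0 ≤ ∑ a, ∑ a', Q (πn ⁅e a, e a'⁆) (πn ⁅e a, e a'⁆) :=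
      Finset.sum_nonneg fun a _ => Finset.sum_nonneg fun b _ => hQnn _
    have e1 : ∑ a, killingForm ℝ 𝔤 (s • e a) (s • e a)
        = (s * s) * ∑ a, killingForm ℝ 𝔤 (e a) (e a) := by
      rw [Finset.mul_sum]
      refine Finset.sum_congr rfl fun a _ => ?_
      simp only [map_smul, LinearMap.smul_apply, smul_eq_mul]; ring
    have e2 : ∑ a, ∑ b, Q (πl ⁅s • e a, vb b⁆) (πl ⁅s • e a, vb b⁆)
        = (s * s) * ∑ a, ∑ b, Q (πl ⁅e a, vb b⁆) (πl ⁅e a, vb b⁆) := by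
      simp only [Finset.mul_sum]
      refine Finset.sum_congr rfl fun a _ => Finset.sum_congr rfl fun b _ => ?_
      simp only [smul_lie, map_smul, LinearMap.smul_apply, smul_eq_mul]; ring
    have e3 : ∑ a, ∑ b, (c • Q) (πn ⁅s • e a, s • e b⁆) (πn ⁅s • e a, s • e b⁆)
        = (s * s) * ∑ a, ∑ b, Q (πn ⁅e a, e b⁆) (πn ⁅e a, e b⁆) := by
      simp only [Finset.mul_sum]
      refine Finset.sum_congr rfl fun a _ => Finset.sum_congr rfl fun b _ => ?_
      simp only [smul_lie, lie_smul, map_smul, LinearMap.smul_apply, smul_eq_mul]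
      linear_combination (s * s * Q (πn ⁅e a, e b⁆) (πn ⁅e a, e b⁆)) * hcs
    rw [e1, e2, e3]
    have := mul_nonneg (mul_self_nonneg s) (sub_nonneg.2 hsum)
    have := mul_nonneg (mul_self_nonneg s) h3
    linarith
  · intro v w; simp [hQsymm v w]
  · intro v _ hv
    simpa using mul_pos hcpos (hQpos v hv)
  · intro z _ v _ w _
    simp only [LinearMap.smul_apply, smul_eq_mul]
    rw [← mul_add, hQad, mul_zero]
  · exact fun a => 𝔫.smul_mem _ (he a)
  · apply le_antisymm
    · rw [Submodule.span_le]
      rintro _ ⟨a, rfl⟩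
      exact 𝔫.smul_mem _ (he a)
    · conv_lhs => rw [← hespan]
      rw [Submodule.span_le]
      rintro _ ⟨a, rfl⟩
      have := (Submodule.span ℝ (Set.range fun a => s • e a)).smul_mem s⁻¹
        (Submodule.subset_span ⟨a, rfl⟩)
      simpa [smul_smul, inv_mul_cancel₀ hs0] using this
  · intro a b
    simp only [map_smul, LinearMap.smul_apply, smul_eq_mul]
    rw [heo]
    split_ifs
    · linarith
    · simp
  · have : ∀ a, T (s • e a) (s • e a) = (s * s) * T (e a) (e a) := fun a => by
      simp only [map_smul, LinearMap.smul_apply, smul_eq_mul]; ring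
    simp only [this, ← Finset.mul_sum]
    rw [← hc]; linarith
end

section
/- There exists a constant C ∈ ℝ such that S(g) ≤ C for every inner product g on 𝔪 satisfying tr_g T = 1. -/
open scoped BigOperators

theorem bound_aux0 {V : Type*} [NormedAddCommGroup V] [InnerProductSpace ℝ V]
    [FiniteDimensional ℝ V] (B : V →ₗ[ℝ] V →ₗ[ℝ] ℝ) :
    ∃ c : ℝ, ∀ v, -(B v v) ≤ c * inner ℝ v v := by
  let B' : V →L[ℝ] V →L[ℝ] ℝ := LinearMap.toContinuousLinearMap
    ((LinearMap.toContinuousLinearMap (𝕜 := ℝ) (E := V) (F' := ℝ)).toLinearMap ∘ₗ B)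
  refine ⟨‖B'‖, fun v => ?_⟩
  have h1 : ‖B v v‖ ≤ ‖B'‖ * ‖v‖ * ‖v‖ := B'.le_opNorm₂ v v
  rw [real_inner_self_eq_norm_mul_norm v, ← mul_assoc]
  exact (neg_le_abs _).trans h1

theorem bound_aux {V : Type*} [AddCommGroup V] [Module ℝ V] [FiniteDimensional ℝ V]
    (T B : V →ₗ[ℝ] V →ₗ[ℝ] ℝ) (hs : ∀ v w, T v w = T w v)
    (hp : ∀ v, v ≠ 0 → 0 < T v v) : ∃ c : ℝ, ∀ v, -(B v v) ≤ c * T v v := by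
  let core : InnerProductSpace.Core ℝ V :=
    { inner := fun x y => T x y
      conj_inner_symm := fun x y => by simp [hs x y]
      re_inner_nonneg := fun x => by
        by_cases h : x = 0
        · simp [h]
        · simpa using (hp x h).le
      add_left := fun x y z => by simp
      smul_left := fun x y r => by simp
      definite := fun x h => by
        by_contra h0
        exact (hp x h0).ne' h }
  exact @bound_aux0 V core.toNormedAddCommGroup (InnerProductSpace.ofCore core.toCore) ‹_› B

/-- There is a constant `C` with `S(g) ≤ C` for every inner product `g` on `𝔪`
satisfying `tr_g T = 1`, where
`S(g) = −(1/2)·tr_g B|𝔪 − (1/4)·|Δ(𝔪,𝔪,𝔪)|_g²`. -/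
theorem stmt6 {𝔤 : Type*} [LieRing 𝔤] [LieAlgebra ℝ 𝔤] [FiniteDimensional ℝ 𝔤]
    (Q : 𝔤 →ₗ[ℝ] 𝔤 →ₗ[ℝ] ℝ)
    (hQsymm : ∀ v w, Q v w = Q w v)
    (hQpos : ∀ v, v ≠ 0 → 0 < Q v v)
    (hQad : ∀ z v w : 𝔤, Q ⁅z, v⁆ w + Q v ⁅z, w⁆ = 0)
    (𝔪 : Submodule ℝ 𝔤)
    -- T : a positive-definite symmetric bilinear form on 𝔪
    (T : 𝔤 →ₗ[ℝ] 𝔤 →ₗ[ℝ] ℝ)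
    (hTsymm : ∀ v w, T v w = T w v)
    (hTpos : ∀ v ∈ 𝔪, v ≠ 0 → 0 < T v v)
    -- the Q-orthogonal projection onto 𝔪
    (πm : 𝔤 →ₗ[ℝ] 𝔤)
    (hπm_mem : ∀ v, πm v ∈ 𝔪) (hπm_id : ∀ v ∈ 𝔪, πm v = v)
    (hπm_orth : ∀ v, ∀ w ∈ 𝔪, Q (v - πm v) w = 0) :
    ∃ C : ℝ, ∀ (g : 𝔤 →ₗ[ℝ] 𝔤 →ₗ[ℝ] ℝ),
      (∀ v w, g v w = g w v) →
      (∀ v ∈ 𝔪, v ≠ 0 → 0 < g v v) →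
      ∀ (N : ℕ) (u : Fin N → 𝔤),
        (∀ a, u a ∈ 𝔪) →
        Submodule.span ℝ (Set.range u) = 𝔪 →
        (∀ a b, g (u a) (u b) = if a = b then 1 else 0) →
        (∑ a, T (u a) (u a)) = 1 →
        -(1/2) * (∑ a, killingForm ℝ 𝔤 (u a) (u a))
            - (1/4) * (∑ a, ∑ b', g (πm ⁅u a, u b'⁆) (πm ⁅u a, u b'⁆)) ≤ C := by
  obtain ⟨c, hc⟩ := bound_aux (T.domRestrict₁₂ 𝔪 𝔪) ((killingForm ℝ 𝔤).domRestrict₁₂ 𝔪 𝔪)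
    (fun v w => hTsymm v w)
    (fun v hv => hTpos v v.2 (by simpa using hv))
  refine ⟨c / 2, ?_⟩
  intro g _ hg N u hu _ _ ht
  have h1 : ∑ a, -(killingForm ℝ 𝔤 (u a) (u a)) ≤ ∑ a, c * T (u a) (u a) :=
    Finset.sum_le_sum fun a _ => hc ⟨u a, hu a⟩
  rw [← Finset.mul_sum, ht, Finset.sum_neg_distrib] at h1
  have h2 : 0 ≤ ∑ a, ∑ b', g (πm ⁅u a, u b'⁆) (πm ⁅u a, u b'⁆) := by
    refine Finset.sum_nonneg fun a _ => Finset.sum_nonneg fun b _ => ?_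
    by_cases h : πm ⁅u a, u b⁆ = 0
    · simp [h]
    · exact (hg _ (hπm_mem _) h).le
  linarith
end

section
/- Let λ = (2,2,2) and let T₁, T₂, T₃ > 0. Then there exist x₁,x₂,x₃ > 0 and c > 0 such that R_i(λ,x) = c·T_i for i = 1,2,3. Moreover, if (x,c) and (x′,c′) are two such solutions, then c = c′ and x′ = t·x for some t > 0. -/
open scoped BigOperators

/-- The diagonal components of the Ricci curvature of the left-invariant metric
`g(V_i,V_j) = δ_{ij} x_i` in a Milnor frame with structure constants `lam`:
`R_i(λ,x) = x_i (λ_i² x_i² − (λ_j x_j − λ_k x_k)²) / (2 x₁ x₂ x₃)`, where `(i,j,k)`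
is the cyclic permutation of `(1,2,3)` starting at `i`. -/
noncomputable def ricMilnor (lam x : Fin 3 → ℝ) (i : Fin 3) : ℝ :=
  x i * ((lam i) ^ 2 * (x i) ^ 2 - (lam (i + 1) * x (i + 1) - lam (i + 2) * x (i + 2)) ^ 2)
    / (2 * x 0 * x 1 * x 2)

lemma aux_ric (x y z : ℝ) (hx : 0 < x) (hy : 0 < y) (hz : 0 < z) (r : ℝ) :
    x * (2 ^ 2 * x ^ 2 - (2 * y - 2 * z) ^ 2) / (2 * x * y * z) = r ↔
      2 * ((x + z - y) * (x + y - z)) = r * (y * z) := by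
  rw [div_eq_iff (by positivity)]
  constructor
  · intro h
    have h2 : (2 * x) * (2 * ((x + z - y) * (x + y - z))) = (2 * x) * (r * (y * z)) := by
      linear_combination h
    exact mul_left_cancel₀ (by positivity) h2
  · intro h
    linear_combination (2 * x) * h

lemma aux_sys (x : Fin 3 → ℝ) (c T₁ T₂ T₃ : ℝ) (hx : ∀ i, 0 < x i) :
    (∀ i, ricMilnor ![2, 2, 2] x i = c * ![T₁, T₂, T₃] i) ↔
      2 * ((x 0 + x 2 - x 1) * (x 0 + x 1 - x 2)) = c * T₁ * (x 1 * x 2) ∧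
      2 * ((x 1 + x 0 - x 2) * (x 1 + x 2 - x 0)) = c * T₂ * (x 2 * x 0) ∧
      2 * ((x 2 + x 1 - x 0) * (x 2 + x 0 - x 1)) = c * T₃ * (x 0 * x 1) := by
  have e1 : 2 * x 0 * x 1 * x 2 = 2 * x 1 * x 2 * x 0 := by ring
  have e2 : 2 * x 0 * x 1 * x 2 = 2 * x 2 * x 0 * x 1 := by ring
  have a0 := aux_ric (x 0) (x 1) (x 2) (hx 0) (hx 1) (hx 2) (c * T₁)
  have a1 := aux_ric (x 1) (x 2) (x 0) (hx 1) (hx 2) (hx 0) (c * T₂)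
  have a2 := aux_ric (x 2) (x 0) (x 1) (hx 2) (hx 0) (hx 1) (c * T₃)
  rw [← e1] at a1
  rw [← e2] at a2
  rw [← a0, ← a1, ← a2]
  have f1 : (1 : Fin 3) + 1 = 2 := rfl
  have f2 : (1 : Fin 3) + 2 = 0 := rfl
  have f3 : (2 : Fin 3) + 1 = 0 := rfl
  have f4 : (2 : Fin 3) + 2 = 1 := rfl
  rw [Fin.forall_fin_succ, Fin.forall_fin_succ, Fin.forall_fin_succ]
  simp [ricMilnor, f1, f2, f3, f4]

lemma aux_s (T₁ T₂ T₃ : ℝ) (hT₁ : 0 < T₁) (hT₂ : 0 < T₂) (hT₃ : 0 < T₃) :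
    ∃ s₁ s₂ s₃ : ℝ, 0 < s₁ ∧ 0 < s₂ ∧ 0 < s₃ ∧
      T₁ = 8 * (s₂ * s₃) ∧ T₂ = 8 * (s₃ * s₁) ∧ T₃ = 8 * (s₁ * s₂) := by
  have hm : 0 < Real.sqrt (T₁ * T₂ * T₃ / 8) := Real.sqrt_pos.2 (by positivity)
  have hq : Real.sqrt (T₁ * T₂ * T₃ / 8) ^ 2 = T₁ * T₂ * T₃ / 8 :=
    Real.sq_sqrt (by positivity)
  generalize Real.sqrt (T₁ * T₂ * T₃ / 8) = m at hm hq
  refine ⟨m / T₁, m / T₂, m / T₃, by positivity, by positivity, by positivity, ?_, ?_, ?_⟩ <;>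
    (field_simp; linarith)

lemma aux_k (s₁ s₂ s₃ : ℝ) (h₁ : 0 < s₁) (h₂ : 0 < s₂) (h₃ : 0 < s₃) :
    ∃ k : ℝ, 0 < k ∧ 1 / (1 + k * s₁) + 1 / (1 + k * s₂) + 1 / (1 + k * s₃) = 2 := by
  set K := 2 / s₁ + 2 / s₂ + 2 / s₃ with hK
  have p1 : 0 < 2 / s₁ := by positivity
  have p2 : 0 < 2 / s₂ := by positivity
  have p3 : 0 < 2 / s₃ := by positivity
  have hK0 : 0 ≤ K := by positivity
  have key : ∀ s : ℝ, 0 < s → 2 / s ≤ K → 1 / (1 + K * s) ≤ 1 / 3 := by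
    intro s hs h
    rw [div_le_iff₀ hs] at h
    exact one_div_le_one_div_of_le (by norm_num) (by linarith)
  have hc : ContinuousOn (fun k : ℝ => 1 / (1 + k * s₁) + 1 / (1 + k * s₂) + 1 / (1 + k * s₃))
      (Set.Icc 0 K) := by
    have : ∀ s : ℝ, 0 < s → ContinuousOn (fun k : ℝ => 1 / (1 + k * s)) (Set.Icc 0 K) := by
      intro s hs
      apply ContinuousOn.div (by fun_prop) (by fun_prop)
      intro k hk
      have := mul_nonneg hk.1 hs.le
      positivity
    exact ((this _ h₁).add (this _ h₂)).add (this _ h₃)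
  have := intermediate_value_Icc' hK0 hc
  have k1 := key s₁ h₁ (by linarith)
  have k2 := key s₂ h₂ (by linarith)
  have k3 := key s₃ h₃ (by linarith)
  obtain ⟨k, hk, hk2⟩ := this (show (2 : ℝ) ∈ _ from ⟨by linarith, by norm_num⟩)
  refine ⟨k, lt_of_le_of_ne hk.1 ?_, hk2⟩
  rintro rfl
  norm_num at hk2

lemma aux_sol (x y z c s₁ s₂ s₃ : ℝ) (hx : 0 < x) (hy : 0 < y) (hz : 0 < z) (hc : 0 < c)
    (h₁ : 0 < s₁) (h₂ : 0 < s₂) (h₃ : 0 < s₃)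
    (e1 : 2 * ((x + z - y) * (x + y - z)) = c * (8 * (s₂ * s₃)) * (y * z))
    (e2 : 2 * ((y + x - z) * (y + z - x)) = c * (8 * (s₃ * s₁)) * (z * x))
    (e3 : 2 * ((z + y - x) * (z + x - y)) = c * (8 * (s₁ * s₂)) * (x * y)) :
    y + z - x = 2 * x * (Real.sqrt c * s₁) := by
  have hbd : 0 < (x + z - y) * (x + y - z) := by
    have : 0 < c * (8 * (s₂ * s₃)) * (y * z) := by positivity
    linarith
  have had : 0 < (y + x - z) * (y + z - x) := by
    have : 0 < c * (8 * (s₃ * s₁)) * (z * x) := by positivity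
    linarith
  have ha : 0 < y + z - x := by
    by_contra hn
    push Not at hn
    have : y + x - z < 0 := by
      by_contra h0
      push Not at h0
      nlinarith
    linarith
  have hk := Real.sqrt_pos.2 hc
  have hk2 := Real.sq_sqrt hc.le
  generalize Real.sqrt c = k at hk hk2
  subst hk2
  have hsq : (y + z - x) ^ 2 = (2 * x * (k * s₁)) ^ 2 := by
    have hne : (2 * ((x + z - y) * (x + y - z))) ≠ 0 := by positivity
    apply mul_left_cancel₀ hne
    have : (2 * ((x + z - y) * (x + y - z))) * (y + z - x) ^ 2 * 2 =
       (2 * ((y + x - z) * (y + z - x))) * (2 * ((z + y - x) * (z + x - y))) := by ring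
    rw [e2, e3] at this
    rw [e1] at this ⊢
    linear_combination this / 2
  exact (pow_left_inj₀ ha.le (by positivity) (by norm_num)).1 hsq

lemma aux_mono (s₁ s₂ s₃ k k' : ℝ) (h₁ : 0 < s₁) (h₂ : 0 < s₂) (h₃ : 0 < s₃) (hk : 0 < k)
    (h : k < k') : 1 / (1 + k' * s₁) + 1 / (1 + k' * s₂) + 1 / (1 + k' * s₃) <
      1 / (1 + k * s₁) + 1 / (1 + k * s₂) + 1 / (1 + k * s₃) := by
  have key : ∀ s : ℝ, 0 < s → 1 / (1 + k' * s) < 1 / (1 + k * s) := by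
    intro s hs
    apply one_div_lt_one_div_of_lt (by positivity)
    nlinarith
  have := key _ h₁
  have := key _ h₂
  have := key _ h₃
  linarith

lemma aux_all (x : Fin 3 → ℝ) (c s₁ s₂ s₃ : ℝ) (hx : ∀ i, 0 < x i) (hc : 0 < c)
    (h₁ : 0 < s₁) (h₂ : 0 < s₂) (h₃ : 0 < s₃)
    (h : ∀ i, ricMilnor ![2, 2, 2] x i =
      c * ![8 * (s₂ * s₃), 8 * (s₃ * s₁), 8 * (s₁ * s₂)] i) :
    ∃ S k : ℝ, 0 < S ∧ 0 < k ∧ c = k ^ 2 ∧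
      1 / (1 + k * s₁) + 1 / (1 + k * s₂) + 1 / (1 + k * s₃) = 2 ∧
      x 0 = S * (1 / (1 + k * s₁)) ∧ x 1 = S * (1 / (1 + k * s₂)) ∧
      x 2 = S * (1 / (1 + k * s₃)) := by
  rw [aux_sys x c _ _ _ hx] at h
  obtain ⟨e1, e2, e3⟩ := h
  have a1 := aux_sol _ _ _ _ _ _ _ (hx 0) (hx 1) (hx 2) hc h₁ h₂ h₃ e1 e2 e3
  have a2 := aux_sol _ _ _ _ _ _ _ (hx 1) (hx 2) (hx 0) hc h₂ h₃ h₁ e2 e3 e1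
  have a3 := aux_sol _ _ _ _ _ _ _ (hx 2) (hx 0) (hx 1) hc h₃ h₁ h₂ e3 e1 e2
  have hk := Real.sqrt_pos.2 hc
  have hk2 := Real.sq_sqrt hc.le
  generalize Real.sqrt c = k at *
  have p0 := hx 0
  have p1 := hx 1
  have p2 := hx 2
  have b1 : x 0 = (x 0 + x 1 + x 2) / 2 * (1 / (1 + k * s₁)) := by
    field_simp; linarith
  have b2 : x 1 = (x 0 + x 1 + x 2) / 2 * (1 / (1 + k * s₂)) := by
    field_simp; linarith
  have b3 : x 2 = (x 0 + x 1 + x 2) / 2 * (1 / (1 + k * s₃)) := by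
    field_simp; linarith
  refine ⟨(x 0 + x 1 + x 2) / 2, k, by positivity, hk, hk2.symm, ?_, b1, b2, b3⟩
  have hne : (x 0 + x 1 + x 2) / 2 ≠ 0 := by positivity
  apply mul_left_cancel₀ hne
  linarith

theorem stmt7 (T₁ T₂ T₃ : ℝ) (hT₁ : 0 < T₁) (hT₂ : 0 < T₂) (hT₃ : 0 < T₃) :
    (∃ (x : Fin 3 → ℝ) (c : ℝ), (∀ i, 0 < x i) ∧ 0 < c ∧
      (∀ i, ricMilnor ![2, 2, 2] x i = c * ![T₁, T₂, T₃] i)) ∧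
    (∀ (x x' : Fin 3 → ℝ) (c c' : ℝ),
      (∀ i, 0 < x i) → 0 < c → (∀ i, ricMilnor ![2, 2, 2] x i = c * ![T₁, T₂, T₃] i) →
      (∀ i, 0 < x' i) → 0 < c' → (∀ i, ricMilnor ![2, 2, 2] x' i = c' * ![T₁, T₂, T₃] i) →
      c = c' ∧ ∃ t : ℝ, 0 < t ∧ ∀ i, x' i = t * x i) := by
  obtain ⟨s₁, s₂, s₃, h₁, h₂, h₃, rfl, rfl, rfl⟩ := aux_s T₁ T₂ T₃ hT₁ hT₂ hT₃
  constructor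
  · obtain ⟨k, hk, hs⟩ := aux_k s₁ s₂ s₃ h₁ h₂ h₃
    have q1 : 0 < 1 / (1 + k * s₁) := by positivity
    have q2 : 0 < 1 / (1 + k * s₂) := by positivity
    have q3 : 0 < 1 / (1 + k * s₃) := by positivity
    have r1 : 1 / (1 + k * s₁) * (1 + k * s₁) = 1 := by field_simp
    have r2 : 1 / (1 + k * s₂) * (1 + k * s₂) = 1 := by field_simp
    have r3 : 1 / (1 + k * s₃) * (1 + k * s₃) = 1 := by field_simp
    generalize 1 / (1 + k * s₁) = x at *
    generalize 1 / (1 + k * s₂) = y at *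
    generalize 1 / (1 + k * s₃) = z at *
    have hpos : ∀ i, 0 < (![x, y, z] : Fin 3 → ℝ) i := by
      intro i
      fin_cases i <;> simpa
    refine ⟨![x, y, z], k ^ 2, hpos, by positivity, ?_⟩
    rw [aux_sys _ _ _ _ _ hpos]
    have t1 : y + z - x = 2 * x * (k * s₁) := by linarith
    have t2 : z + x - y = 2 * y * (k * s₂) := by linarith
    have t3 : x + y - z = 2 * z * (k * s₃) := by linarith
    simp only [Matrix.cons_val]
    rw [add_comm x z, add_comm y x, add_comm z y, t1, t2, t3]
    refine ⟨by ring, by ring, by ring⟩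
  · intro x x' c c' hx hc h hx' hc' h'
    obtain ⟨S, k, hS, hk, rfl, hs, a0, a1, a2⟩ := aux_all x c s₁ s₂ s₃ hx hc h₁ h₂ h₃ h
    obtain ⟨S', k', hS', hk', rfl, hs', b0, b1, b2⟩ :=
      aux_all x' c' s₁ s₂ s₃ hx' hc' h₁ h₂ h₃ h'
    have hkk : k = k' := by
      rcases lt_trichotomy k k' with hl | hl | hl
      · have := aux_mono s₁ s₂ s₃ k k' h₁ h₂ h₃ hk hl
        linarith
      · exact hl
      · have := aux_mono s₁ s₂ s₃ k' k h₁ h₂ h₃ hk' hl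
        linarith
    subst hkk
    refine ⟨rfl, S' / S, by positivity, ?_⟩
    have key : ∀ w : ℝ, S' * w = S' / S * (S * w) := by
      intro w
      field_simp
    intro i
    fin_cases i
    · change x' 0 = S' / S * x 0
      rw [a0, b0, ← key]
    · change x' 1 = S' / S * x 1
      rw [a1, b1, ← key]
    · change x' 2 = S' / S * x 2
      rw [a2, b2, ← key]
end

section
/- Let λ = (2,2,2), let T₁ > 0 and T₂ = T₃ = 0. Then there exist x₁,x₂,x₃ > 0 and c > 0 such that R_i(λ,x) = c·T_i for i = 1,2,3. Moreover, all such solutions (x,c) have the same value of c, and there exist two solutions (x,c) and (x′,c) such that x′ is not a positive scalar multiple of x. -/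
open scoped BigOperators

lemma aux_c (T c : ℝ) (x : Fin 3 → ℝ) (hx : ∀ i, 0 < x i)
    (h : ∀ i, ricMilnor ![2, 2, 2] x i = c * ![T, 0, 0] i) : c * T = 8 := by
  have h0 := h 0
  have h1 := h 1
  have h2 := h 2
  have e1 : (1 : Fin 3) + 1 = 2 := rfl
  have e2 : (1 : Fin 3) + 2 = 0 := rfl
  have e3 : (2 : Fin 3) + 1 = 0 := rfl
  have e4 : (2 : Fin 3) + 2 = 1 := rfl
  have p0 := hx 0
  have p1 := hx 1
  have p2 := hx 2
  simp only [ricMilnor, e1, e2, e3, e4, zero_add, Matrix.cons_val] at h0 h1 h2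
  generalize x 0 = a at *
  generalize x 1 = b at *
  generalize x 2 = d at *
  have hne : 2 * a * b * d ≠ 0 := by positivity
  rw [div_eq_iff hne] at h0 h1 h2
  have k1 : (b - d + a) * (b + d - a) = 0 := by
    have : b * ((b - d + a) * (b + d - a)) = 0 := by linarith
    exact (mul_eq_zero.mp this).resolve_left p1.ne'
  have k2 : (d - a + b) * (d + a - b) = 0 := by
    have : d * ((d - a + b) * (d + a - b)) = 0 := by linarith
    exact (mul_eq_zero.mp this).resolve_left p2.ne'
  have k : a = b + d := by
    rcases mul_eq_zero.mp k1 with q | q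
    · rcases mul_eq_zero.mp k2 with r | r <;> linarith
    · linarith
  subst k
  have : (c * T - 8) * (2 * (b + d) * b * d) = 0 := by linarith
  have := (mul_eq_zero.mp this).resolve_right hne
  linarith

lemma aux_sol_s8 (T b d : ℝ) (hT : 0 < T) (hb : 0 < b) (hd : 0 < d) :
    (∀ i, 0 < (![b + d, b, d] : Fin 3 → ℝ) i) ∧ 0 < 8 / T ∧
    (∀ i, ricMilnor ![2, 2, 2] ![b + d, b, d] i = 8 / T * ![T, 0, 0] i) := by
  have e1 : (1 : Fin 3) + 1 = 2 := rfl
  have e2 : (1 : Fin 3) + 2 = 0 := rfl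
  have e3 : (2 : Fin 3) + 1 = 0 := rfl
  have e4 : (2 : Fin 3) + 2 = 1 := rfl
  have hs : 0 < b + d := by positivity
  have hne : 2 * (b + d) * b * d ≠ 0 := by positivity
  refine ⟨?_, by positivity, ?_⟩
  · intro i
    fin_cases i
    · exact hs
    · exact hb
    · exact hd
  · rw [Fin.forall_fin_succ, Fin.forall_fin_two]
    refine ⟨?_, ?_, ?_⟩
    · simp only [ricMilnor, zero_add, Matrix.cons_val]
      rw [div_mul_cancel₀ _ hT.ne', div_eq_iff hne]
      ring
    · show ricMilnor ![2, 2, 2] ![b + d, b, d] 1 = 8 / T * 0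
      simp only [ricMilnor, e1, e2, Matrix.cons_val]
      rw [mul_zero, div_eq_iff hne]
      ring
    · show ricMilnor ![2, 2, 2] ![b + d, b, d] 2 = 8 / T * 0
      simp only [ricMilnor, e3, e4, Matrix.cons_val]
      rw [mul_zero, div_eq_iff hne]
      ring

theorem stmt8 (T₁ : ℝ) (hT₁ : 0 < T₁) :
    (∃ (x : Fin 3 → ℝ) (c : ℝ), (∀ i, 0 < x i) ∧ 0 < c ∧ (∀ i, ricMilnor ![2, 2, 2] x i = c * ![T₁, 0, 0] i)) ∧
    (∀ (x x' : Fin 3 → ℝ) (c c' : ℝ),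
      (∀ i, 0 < x i) → 0 < c → (∀ i, ricMilnor ![2, 2, 2] x i = c * ![T₁, 0, 0] i) →
      (∀ i, 0 < x' i) → 0 < c' → (∀ i, ricMilnor ![2, 2, 2] x' i = c' * ![T₁, 0, 0] i) →
      c = c') ∧
    (∃ (x x' : Fin 3 → ℝ) (c : ℝ),
      ((∀ i, 0 < x i) ∧ 0 < c ∧ (∀ i, ricMilnor ![2, 2, 2] x i = c * ![T₁, 0, 0] i)) ∧
      ((∀ i, 0 < x' i) ∧ 0 < c ∧ (∀ i, ricMilnor ![2, 2, 2] x' i = c * ![T₁, 0, 0] i)) ∧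
      ¬ (∃ t : ℝ, 0 < t ∧ ∀ i, x' i = t * x i)) := by
  refine ⟨⟨_, _, aux_sol_s8 T₁ 1 1 hT₁ one_pos one_pos⟩, ?_, ?_⟩
  · intro x x' c c' hx _ h hx' _ h'
    have a := aux_c T₁ c x hx h
    have b := aux_c T₁ c' x' hx' h'
    exact mul_right_cancel₀ hT₁.ne' (a.trans b.symm)
  · refine ⟨_, _, _, aux_sol_s8 T₁ 1 1 hT₁ one_pos one_pos, aux_sol_s8 T₁ 1 2 hT₁ one_pos two_pos, ?_⟩
    rintro ⟨t, _, h⟩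
    have h1 := h 1
    have h2 := h 2
    simp only [Matrix.cons_val] at h1 h2
    linarith
end

section
/- Let λ = (2,2,2), let T₁ > 0, T₂ > 0 and T₃ = 0. Then there do NOT exist x₁,x₂,x₃ > 0 and c > 0 such that R_i(λ,x) = c·T_i for i = 1,2,3. -/
open scoped BigOperators

theorem stmt9 (T₁ T₂ : ℝ) (hT₁ : 0 < T₁) (hT₂ : 0 < T₂) :
    ¬ ∃ (x : Fin 3 → ℝ) (c : ℝ), (∀ i, 0 < x i) ∧ 0 < c ∧ (∀ i, ricMilnor ![2, 2, 2] x i = c * ![T₁, T₂, 0] i) := by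
  rintro ⟨x, c, hx, hc, h⟩
  have h0 := h 0
  have h1 := h 1
  have h2 := h 2
  have e1 : (1 : Fin 3) + 1 = 2 := rfl
  have e2 : (1 : Fin 3) + 2 = 0 := rfl
  have e3 : (2 : Fin 3) + 1 = 0 := rfl
  have e4 : (2 : Fin 3) + 2 = 1 := rfl
  have p0 := hx 0
  have p1 := hx 1
  have p2 := hx 2
  simp only [ricMilnor, e1, e2, e3, e4, zero_add, Matrix.cons_val_zero, Matrix.cons_val_one,
    Matrix.cons_val] at h0 h1 h2
  have hcT1 : 0 < c * T₁ := mul_pos hc hT₁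
  have hcT2 : 0 < c * T₂ := mul_pos hc hT₂
  generalize x 0 = a at *
  generalize x 1 = b at *
  generalize x 2 = d at *
  have hD : 2 * a * b * d ≠ 0 := by positivity
  rw [mul_zero, div_eq_zero_iff, or_iff_left hD, mul_eq_zero, or_iff_right p2.ne'] at h2
  have h3 : (d - (a - b)) * (d + (a - b)) = 0 := by linarith
  rcases mul_eq_zero.mp h3 with h4 | h4
  · have : d = a - b := by linarith
    subst this
    ring_nf at h1
    linarith
  · have : d = b - a := by linarith
    subst this
    ring_nf at h0
    linarith
end

section
/- Let λ = (2,2,2), let T₁ > 0, T₂ < 0, T₃ < 0. Then there exist x₁,x₂,x₃ > 0 and c > 0 such that R_i(λ,x) = c·T_i for i = 1,2,3 if and only if (T₁+T₂+T₃)³ ≥ 27·T₁T₂T₃. Moreover, if (x,c) and (x′,c) are two solutions with the same value of c, then x′ = t·x for some t > 0. -/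
open scoped BigOperators

theorem ric_expand (x : Fin 3 → ℝ) (c T₁ T₂ T₃ : ℝ) (hx : ∀ i, 0 < x i) :
    (∀ i, ricMilnor ![2, 2, 2] x i = c * ![T₁, T₂, T₃] i) ↔
    (2 * (x 0 ^ 2 - (x 1 - x 2) ^ 2) = c * T₁ * (x 1 * x 2) ∧
     2 * (x 1 ^ 2 - (x 2 - x 0) ^ 2) = c * T₂ * (x 2 * x 0) ∧
     2 * (x 2 ^ 2 - (x 0 - x 1) ^ 2) = c * T₃ * (x 0 * x 1)) := by
  have h0 := hx 0
  have h1 := hx 1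
  have h2 := hx 2
  have key : ∀ i, ricMilnor ![2, 2, 2] x i =
      x i * (4 * (x i) ^ 2 - (2 * x (i + 1) - 2 * x (i + 2)) ^ 2) / (2 * x 0 * x 1 * x 2) := by
    intro i
    have h : ∀ j : Fin 3, (![2, 2, 2] : Fin 3 → ℝ) j = 2 := by
      intro j; fin_cases j <;> rfl
    simp only [ricMilnor, h]
    norm_num
  rw [Fin.forall_fin_succ, Fin.forall_fin_two]
  simp only [key]
  have e : ((1 : Fin 3) + 1 = 2) ∧ ((1 : Fin 3) + 2 = 0) ∧ ((2 : Fin 3) + 1 = 0) ∧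
    ((2 : Fin 3) + 2 = 1) ∧ Fin.succ (0 : Fin 2) = 1 ∧ Fin.succ (1 : Fin 2) = 2 := by decide
  obtain ⟨e1, e2, e3, e4, e5, e6⟩ := e
  simp only [e1, e2, e3, e4, e5, e6, zero_add, Matrix.cons_val]
  refine and_congr ?_ (and_congr ?_ ?_)
  · rw [div_eq_iff (by positivity)]
    constructor
    · intro h
      apply mul_left_cancel₀ (mul_pos (two_pos) h0).ne'
      linear_combination h
    · intro h
      linear_combination 2 * x 0 * h
  · rw [div_eq_iff (by positivity)]
    constructor
    · intro h
      apply mul_left_cancel₀ (mul_pos (two_pos) h1).ne'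
      linear_combination h
    · intro h
      linear_combination 2 * x 1 * h
  · rw [div_eq_iff (by positivity)]
    constructor
    · intro h
      apply mul_left_cancel₀ (mul_pos (two_pos) h2).ne'
      linear_combination h
    · intro h
      linear_combination 2 * x 2 * h

theorem sign_aux (x y z c T₁ T₂ T₃ : ℝ) (hx : 0 < x) (hy : 0 < y) (hz : 0 < z) (hc : 0 < c)
    (hT₁ : 0 < T₁) (hT₂ : T₂ < 0)
    (h1 : 2 * (x ^ 2 - (y - z) ^ 2) = c * T₁ * (y * z))
    (h2 : 2 * (y ^ 2 - (z - x) ^ 2) = c * T₂ * (z * x)) :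
    0 < -((y + z - x) * (z + x - y) * (x + y - z)) := by
  have p1 : 0 < (z + x - y) * (x + y - z) := by
    have : 0 < c * T₁ * (y * z) := by positivity
    nlinarith
  have p2 : (y + z - x) * (x + y - z) < 0 := by
    have : 0 < c * (-T₂) * (z * x) := by
      have : 0 < -T₂ := by linarith
      positivity
    nlinarith
  have hd : 0 < x + y - z := by
    by_contra h
    push Not at h
    have : 0 < z + x - y := by linarith
    nlinarith
  have ha : y + z - x < 0 := by
    by_contra h
    push Not at h
    nlinarith [mul_nonneg h hd.le]
  have := mul_pos p1 (neg_pos.mpr ha)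
  linarith

theorem uniq_aux (x y z c T₁ T₂ T₃ : ℝ) (hx : 0 < x) (hy : 0 < y) (hz : 0 < z) (hc : 0 < c)
    (hT₁ : 0 < T₁) (hT₂ : T₂ < 0)
    (h1 : 2 * (x ^ 2 - (y - z) ^ 2) = c * T₁ * (y * z))
    (h2 : 2 * (y ^ 2 - (z - x) ^ 2) = c * T₂ * (z * x))
    (h3 : 2 * (z ^ 2 - (x - y) ^ 2) = c * T₃ * (x * y)) :
    ∃ K : ℝ, 0 < K ∧
      K * x = (T₁ - (T₁ + T₂ + T₃ - 8 / c) / 2) * (T₁ - 8 / c) ∧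
      K * y = (T₂ - (T₁ + T₂ + T₃ - 8 / c) / 2) * (T₂ - 8 / c) ∧
      K * z = (T₃ - (T₁ + T₂ + T₃ - 8 / c) / 2) * (T₃ - 8 / c) := by
  have hm := sign_aux x y z c T₁ T₂ T₃ hx hy hz hc hT₁ hT₂ h1 h2
  have t1 : T₁ = 2 * (x ^ 2 - (y - z) ^ 2) / (c * (y * z)) := by
    rw [eq_div_iff (by positivity)]; linarith
  have t2 : T₂ = 2 * (y ^ 2 - (z - x) ^ 2) / (c * (z * x)) := by
    rw [eq_div_iff (by positivity)]; linarith
  have t3 : T₃ = 2 * (z ^ 2 - (x - y) ^ 2) / (c * (x * y)) := by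
    rw [eq_div_iff (by positivity)]; linarith
  refine ⟨2 * (x + y + z) ^ 2 * (-((y + z - x) * (z + x - y) * (x + y - z))) /
    (c ^ 2 * (x * y * z) ^ 2), by positivity, ?_, ?_, ?_⟩
  all_goals
    rw [t1, t2, t3]
    field_simp
    ring

theorem amgm_aux (w m : ℝ) (hw : 0 < w) (hm : 0 < m) : 27 * (w * m ^ 2) ≤ (w + 2 * m) ^ 3 := by
  have : (w + 2 * m) ^ 3 - 27 * (w * m ^ 2) = (w - m) ^ 2 * (w + 8 * m) := by ring
  have : 0 ≤ (w - m) ^ 2 * (w + 8 * m) := by positivity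
  linarith

theorem nec_aux (x y z c T₁ T₂ T₃ : ℝ) (hx : 0 < x) (hy : 0 < y) (hz : 0 < z) (hc : 0 < c)
    (hT₁ : 0 < T₁) (hT₂ : T₂ < 0)
    (h1 : 2 * (x ^ 2 - (y - z) ^ 2) = c * T₁ * (y * z))
    (h2 : 2 * (y ^ 2 - (z - x) ^ 2) = c * T₂ * (z * x))
    (h3 : 2 * (z ^ 2 - (x - y) ^ 2) = c * T₃ * (x * y)) :
    (T₁ + T₂ + T₃) ^ 3 ≥ 27 * (T₁ * T₂ * T₃) := by
  have hm := sign_aux x y z c T₁ T₂ T₃ hx hy hz hc hT₁ hT₂ h1 h2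
  have t1 : T₁ = 2 * (x ^ 2 - (y - z) ^ 2) / (c * (y * z)) := by
    rw [eq_div_iff (by positivity)]; linarith
  have t2 : T₂ = 2 * (y ^ 2 - (z - x) ^ 2) / (c * (z * x)) := by
    rw [eq_div_iff (by positivity)]; linarith
  have t3 : T₃ = 2 * (z ^ 2 - (x - y) ^ 2) / (c * (x * y)) := by
    rw [eq_div_iff (by positivity)]; linarith
  have hw : 0 < 8 * (x * y * z) := by positivity
  have key := amgm_aux _ _ hw hm
  have hS : T₁ + T₂ + T₃ = (8 * (x * y * z) + 2 * -((y + z - x) * (z + x - y) * (x + y - z))) /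
      (c * (x * y * z)) := by
    rw [t1, t2, t3]; field_simp; ring
  have hP : 27 * (T₁ * T₂ * T₃) = 27 * (8 * (x * y * z) *
      (-((y + z - x) * (z + x - y) * (x + y - z))) ^ 2) / (c * (x * y * z)) ^ 3 := by
    rw [t1, t2, t3]; field_simp; ring
  rw [hS, hP, div_pow]
  exact div_le_div_of_nonneg_right key (by positivity)

theorem exist_aux (T₁ T₂ T₃ : ℝ) (hT₁ : 0 < T₁) (hT₂ : T₂ < 0) (hT₃ : T₃ < 0)
    (h : (T₁ + T₂ + T₃) ^ 3 ≥ 27 * (T₁ * T₂ * T₃)) :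
    ∃ x y z c : ℝ, 0 < x ∧ 0 < y ∧ 0 < z ∧ 0 < c ∧
      2 * (x ^ 2 - (y - z) ^ 2) = c * T₁ * (y * z) ∧
      2 * (y ^ 2 - (z - x) ^ 2) = c * T₂ * (z * x) ∧
      2 * (z ^ 2 - (x - y) ^ 2) = c * T₃ * (x * y) := by
  have hP : 0 < T₁ * T₂ * T₃ := by
    have := mul_pos hT₁ (mul_pos_of_neg_of_neg hT₂ hT₃)
    linarith
  obtain ⟨S, hS⟩ : ∃ S, S = T₁ + T₂ + T₃ := ⟨_, rfl⟩
  rw [← hS] at h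
  have hS0 : 0 < S := by
    by_contra hn
    push Not at hn
    have : S ^ 3 ≤ 0 := by
      have := pow_nonneg (neg_nonneg.mpr hn) 3
      nlinarith
    linarith
  have hcont : ContinuousOn (fun t : ℝ => t ^ 2 * (S - 2 * t)) (Set.Icc 0 (S / 3)) := by fun_prop
  have hmem : T₁ * T₂ * T₃ ∈ Set.Icc ((fun t : ℝ => t ^ 2 * (S - 2 * t)) 0)
      ((fun t : ℝ => t ^ 2 * (S - 2 * t)) (S / 3)) := by
    constructor
    · simp; exact hP.le
    · show _ ≤ (S / 3) ^ 2 * (S - 2 * (S / 3))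
      nlinarith
  obtain ⟨t, ⟨ht0, ht1⟩, ht⟩ := intermediate_value_Icc (by positivity) hcont hmem
  simp only at ht
  obtain ⟨s, hs⟩ : ∃ s, s = S - 2 * t := ⟨_, rfl⟩
  have hs0 : 0 < s := by linarith
  rw [← hs] at ht
  have hT1' : T₁ = s + 2 * t - T₂ - T₃ := by linarith
  refine ⟨(T₁ - t) * (T₁ - s), (T₂ - t) * (T₂ - s), (T₃ - t) * (T₃ - s), 8 / s,
    mul_pos (by linarith) (by linarith), mul_pos_of_neg_of_neg (by linarith) (by linarith),
    mul_pos_of_neg_of_neg (by linarith) (by linarith), by positivity, ?_, ?_, ?_⟩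
  · have k : s * (t - T₁) ^ 2 = T₁ * (s - T₂) * (s - T₃) := by
      subst hT1'
      linear_combination ht
    have e : 2 * (((T₁ - t) * (T₁ - s)) ^ 2 - ((T₂ - t) * (T₂ - s) - (T₃ - t) * (T₃ - s)) ^ 2)
      = 8 * (t - T₁) ^ 2 * ((T₂ - t) * (T₃ - t)) := by subst hT1'; ring
    rw [e]
    field_simp
    linear_combination (T₂ - t) * (T₃ - t) * k
  · have k : s * (t - T₂) ^ 2 = T₂ * (s - T₃) * (s - T₁) := by
      subst hT1'
      linear_combination ht
    have e : 2 * (((T₂ - t) * (T₂ - s)) ^ 2 - ((T₃ - t) * (T₃ - s) - (T₁ - t) * (T₁ - s)) ^ 2)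
      = 8 * (t - T₂) ^ 2 * ((T₃ - t) * (T₁ - t)) := by subst hT1'; ring
    rw [e]
    field_simp
    linear_combination (T₃ - t) * (T₁ - t) * k
  · have k : s * (t - T₃) ^ 2 = T₃ * (s - T₁) * (s - T₂) := by
      subst hT1'
      linear_combination ht
    have e : 2 * (((T₃ - t) * (T₃ - s)) ^ 2 - ((T₁ - t) * (T₁ - s) - (T₂ - t) * (T₂ - s)) ^ 2)
      = 8 * (t - T₃) ^ 2 * ((T₁ - t) * (T₂ - t)) := by subst hT1'; ring
    rw [e]
    field_simp
    linear_combination (T₁ - t) * (T₂ - t) * k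

theorem stmt10 (T₁ T₂ T₃ : ℝ) (hT₁ : 0 < T₁) (hT₂ : T₂ < 0) (hT₃ : T₃ < 0) :
    ((∃ (x : Fin 3 → ℝ) (c : ℝ), (∀ i, 0 < x i) ∧ 0 < c ∧ (∀ i, ricMilnor ![2, 2, 2] x i = c * ![T₁, T₂, T₃] i)) ↔ (T₁ + T₂ + T₃) ^ 3 ≥ 27 * (T₁ * T₂ * T₃)) ∧
    (∀ (x x' : Fin 3 → ℝ) (c : ℝ),
      (∀ i, 0 < x i) → 0 < c → (∀ i, ricMilnor ![2, 2, 2] x i = c * ![T₁, T₂, T₃] i) →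
      (∀ i, 0 < x' i) → 0 < c → (∀ i, ricMilnor ![2, 2, 2] x' i = c * ![T₁, T₂, T₃] i) →
      (∃ t : ℝ, 0 < t ∧ ∀ i, x' i = t * x i)) := by
  refine ⟨⟨?_, ?_⟩, ?_⟩
  · rintro ⟨x, c, hx, hc, h⟩
    obtain ⟨h1, h2, h3⟩ := (ric_expand x c T₁ T₂ T₃ hx).1 h
    exact nec_aux (x 0) (x 1) (x 2) c T₁ T₂ T₃ (hx 0) (hx 1) (hx 2) hc hT₁ hT₂ h1 h2 h3
  · intro h
    obtain ⟨x, y, z, c, hx, hy, hz, hc, h1, h2, h3⟩ := exist_aux T₁ T₂ T₃ hT₁ hT₂ hT₃ h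
    have hp : ∀ i, 0 < (![x, y, z] : Fin 3 → ℝ) i := by
      intro i
      fin_cases i
      · exact hx
      · exact hy
      · exact hz
    exact ⟨![x, y, z], c, hp, hc, (ric_expand _ c T₁ T₂ T₃ hp).2 ⟨h1, h2, h3⟩⟩
  · intro x x' c hx hc h hx' _ h'
    obtain ⟨h1, h2, h3⟩ := (ric_expand x c T₁ T₂ T₃ hx).1 h
    obtain ⟨h1', h2', h3'⟩ := (ric_expand x' c T₁ T₂ T₃ hx').1 h'
    obtain ⟨K, hK, a1, a2, a3⟩ :=
      uniq_aux (x 0) (x 1) (x 2) c T₁ T₂ T₃ (hx 0) (hx 1) (hx 2) hc hT₁ hT₂ h1 h2 h3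
    obtain ⟨L, hL, b1, b2, b3⟩ :=
      uniq_aux (x' 0) (x' 1) (x' 2) c T₁ T₂ T₃ (hx' 0) (hx' 1) (hx' 2) hc hT₁ hT₂ h1' h2' h3'
    refine ⟨K / L, by positivity, ?_⟩
    intro i
    rw [div_mul_eq_mul_div, eq_div_iff hL.ne']
    fin_cases i
    · show x' 0 * L = K * x 0
      linarith
    · show x' 1 * L = K * x 1
      linarith
    · show x' 2 * L = K * x 2
      linarith
end

section
/- Let λ = (2,2,−2), let T₁ > 0, T₂ < 0, T₃ < 0. Then there exist x₁,x₂,x₃ > 0 and c > 0 such that R_i(λ,x) = c·T_i for i = 1,2,3 if and only if T₃ + T₁ > 0. Moreover, if (x,c) and (x′,c′) are two such solutions, then c = c′ and x′ = t·x for some t > 0. -/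
open scoped BigOperators

def Sys (T₁ T₂ T₃ y z c : ℝ) : Prop :=
  2 * (1 - (y + z) ^ 2) = c * T₁ * y * z ∧ 2 * (y ^ 2 - (1 + z) ^ 2) = c * T₂ * z ∧
    2 * (z ^ 2 - (1 - y) ^ 2) = c * T₃ * y

lemma sys_iff (T₁ T₂ T₃ : ℝ) (x : Fin 3 → ℝ) (c : ℝ) (hx : ∀ i, 0 < x i) :
    (∀ i, ricMilnor ![2, 2, -2] x i = c * ![T₁, T₂, T₃] i) ↔
      Sys T₁ T₂ T₃ (x 1 / x 0) (x 2 / x 0) c := by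
  have h0 := hx 0
  have h1 := hx 1
  have h2 := hx 2
  have e1 : (1 : Fin 3) + 1 = 2 := rfl
  have e2 : (1 : Fin 3) + 2 = 0 := rfl
  have e3 : (2 : Fin 3) + 1 = 0 := rfl
  have e4 : (2 : Fin 3) + 2 = 1 := rfl
  have n0 := h0.ne'
  have n1 := h1.ne'
  have n2 := h2.ne'
  simp only [Fin.forall_fin_succ, ricMilnor, Sys]
  simp [e1, e2, e3, e4]
  generalize x 0 = a at *
  generalize x 1 = b at *
  generalize x 2 = d at *
  refine and_congr ?_ (and_congr ?_ ?_)
  · field_simp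
  · field_simp
    constructor <;> intro h <;> linarith
  · field_simp

lemma sys_red {T₁ T₂ T₃ y z c : ℝ} (hT₁ : 0 < T₁) (hy : 0 < y) (hz : 0 < z) (hc : 0 < c)
    (h : Sys T₁ T₂ T₃ y z c) : y + z < 1 ∧ T₁ * (z * (1 - y + z)) = -T₃ * (1 + y + z) ∧
      T₁ * (y * (1 + z - y)) = -T₂ * (1 - y - z) := by
  obtain ⟨h1, h2, h3⟩ := h
  have hp : 0 < c * T₁ * y * z := by positivity
  have hlt : y + z < 1 := by nlinarith
  refine ⟨hlt, ?_, ?_⟩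
  · have : (1 - y - z) ≠ 0 := by linarith
    apply mul_right_cancel₀ this
    apply mul_right_cancel₀ (mul_pos hc hy).ne'
    linear_combination (- T₁ * z * c * y / 1) * h3 / 2 + (T₃ * c * y) * h1 / 2
  · have : (1 + y + z) ≠ 0 := by positivity
    apply mul_right_cancel₀ this
    apply mul_right_cancel₀ (mul_pos hc hz).ne'
    linear_combination (- T₁ * z * c * y / 1) * h2 / 2 + (T₂ * c * z) * h1 / 2

lemma mono_z {T₁ T₃ y z z' : ℝ} (hT₁ : 0 < T₁) (hT₃ : T₃ < 0) (hy : 0 < y) (hz : 0 < z)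
    (hz' : 0 < z') (h1 : y + z < 1)
    (h2 : T₁ * (z * (1 - y + z)) = -T₃ * (1 + y + z))
    (h2' : T₁ * (z' * (1 - y + z')) = -T₃ * (1 + y + z')) (h1' : y + z' < 1)
    (l : z < z') : False := by
  have key : z * (1 - y + z) * (1 + y + z') = z' * (1 - y + z') * (1 + y + z) := by
    apply mul_left_cancel₀ hT₁.ne'
    linear_combination (1 + y + z') * h2 - (1 + y + z) * h2'
  have : 0 < (z' - z) * ((1 - y) * (1 + y) + (z + z') * (1 + y) + z * z') := by
    have : 0 < 1 - y := by linarith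
    have := sub_pos.2 l
    positivity
  nlinarith

lemma mono_aux {T₁ T₂ T₃ y z y' z' : ℝ} (hT₁ : 0 < T₁) (hT₃ : T₃ < 0) (hy : 0 < y) (hz : 0 < z)
    (hy' : 0 < y') (hz' : 0 < z') (h1 : y + z < 1)
    (h2 : T₁ * (z * (1 - y + z)) = -T₃ * (1 + y + z))
    (h3 : T₁ * (y * (1 + z - y)) = -T₂ * (1 - y - z))
    (h1' : y' + z' < 1)
    (h2' : T₁ * (z' * (1 - y' + z')) = -T₃ * (1 + y' + z'))
    (h3' : T₁ * (y' * (1 + z' - y')) = -T₂ * (1 - y' - z'))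
    (l : y < y') : False := by
  have key : z * (1 - y + z) * (1 + y' + z') = z' * (1 - y' + z') * (1 + y + z) := by
    apply mul_left_cancel₀ hT₁.ne'
    linear_combination (1 + y' + z') * h2 - (1 + y + z) * h2'
  have key2 : y * (1 + z - y) * (1 - y' - z') = y' * (1 + z' - y') * (1 - y - z) := by
    apply mul_left_cancel₀ hT₁.ne'
    linear_combination (1 - y' - z') * h3 - (1 - y - z) * h3'
  have hzz : z < z' := by
    by_contra hle
    push Not at hle
    have a1 : z' * (1 - y' + z') ≤ z * (1 - y' + z) := by
      apply mul_le_mul hle (by linarith) (by linarith) hz.le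
    have a2 : z' * (1 - y' + z') * (1 + y' + z) ≤ z * (1 - y' + z) * (1 + y' + z') := by
      have : 0 ≤ (z - z') * ((1 - y') * (1 + y') + (z + z') * (1 + y') + z * z') := by
        have : 0 < 1 - y' := by linarith
        have := sub_nonneg.2 hle
        positivity
      nlinarith
    have a3 : z * (1 - y' + z) < z * (1 - y + z) := by
      apply mul_lt_mul_of_pos_left _ hz; linarith
    have a4 := mul_lt_mul_of_pos_right a3 (show 0 < 1 + y' + z' by linarith)
    have p : 0 < z' * (1 - y' + z') := mul_pos hz' (by linarith)
    have a5 := mul_lt_mul_of_pos_left (show 1 + y + z < 1 + y' + z by linarith) p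
    linarith
  obtain ⟨u, hu⟩ : ∃ u, u = 1 - y - z := ⟨_, rfl⟩
  obtain ⟨u', hu'⟩ : ∃ u', u' = 1 - y' - z' := ⟨_, rfl⟩
  have pu : 0 < u' := by linarith
  have luu : u' < u := by linarith
  have k : y * (u + 2 * z) * u' = y' * (u' + 2 * z') * u := by
    rw [hu, hu']; linarith
  have b1 : y * (u * u') < y' * (u * u') := mul_lt_mul_of_pos_right l (by nlinarith)
  have b2 : y * z * u' < y' * z' * u := by
    have := mul_pos hy hz
    gcongr
  linarith

lemma sys_exists (T₁ T₂ T₃ : ℝ) (hT₁ : 0 < T₁) (hT₂ : T₂ < 0) (hT₃ : T₃ < 0) (h : T₃ + T₁ > 0) :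
    ∃ y z c : ℝ, 0 < y ∧ 0 < z ∧ 0 < c ∧ Sys T₁ T₂ T₃ y z c := by
  obtain ⟨p, hp⟩ : ∃ p, p = -T₃ / T₁ := ⟨_, rfl⟩
  obtain ⟨q, hq⟩ : ∃ q, q = -T₂ / T₁ := ⟨_, rfl⟩
  have p0 : 0 < p := by rw [hp]; exact div_pos (by linarith) hT₁
  have q0 : 0 < q := by rw [hq]; exact div_pos (by linarith) hT₁
  have p1 : p < 1 := by rw [hp, div_lt_one hT₁]; linarith
  have e3 : T₃ = -p * T₁ := by rw [hp]; field_simp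
  have e2 : T₂ = -q * T₁ := by rw [hq]; field_simp
  obtain ⟨s, s0, hs⟩ : ∃ s, 0 < s ∧ s * s = p :=
    ⟨√p, Real.sqrt_pos.2 p0, Real.mul_self_sqrt p0.le⟩
  have s1 : s < 1 := by nlinarith
  have ps : p < s := by nlinarith
  have cont : ContinuousOn (fun z : ℝ => p * (z + 1) ^ 2 * (z - p) - q * (z + p) * (p - z ^ 2))
      (Set.Icc p s) := by fun_prop
  obtain ⟨z, ⟨hz1, hz2⟩, hz⟩ := intermediate_value_Ioo ps.le cont (show (0 : ℝ) ∈ Set.Ioo _ _ from by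
    constructor
    · have : 0 < q * (p + p) * (p * (1 - p)) := by
        have := sub_pos.2 p1
        positivity
      nlinarith
    · have : 0 < p * (s + 1) ^ 2 * (s - p) := by
        have := sub_pos.2 ps
        positivity
      have e : p - s ^ 2 = 0 := by rw [← hs]; ring
      rw [e]; linarith)
  simp only at hz
  have z0 : 0 < z := by linarith
  have zp : 0 < z + p := by linarith
  have hzp : z ^ 2 < p := by nlinarith
  obtain ⟨y, hy⟩ : ∃ y, y = (z + 1) * (z - p) / (z + p) := ⟨_, rfl⟩
  have y0 : 0 < y := by
    have := sub_pos.2 hz1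
    rw [hy]; positivity
  have hyz : y * (z + p) = (z + 1) * (z - p) := by rw [hy]; field_simp
  have lt1 : 0 < 1 - y - z := by
    have : (1 - y - z) * (z + p) = 2 * (p - z ^ 2) := by linear_combination -hyz
    exact pos_of_mul_pos_left (by rw [this]; linarith) zp.le
  have E1 : z * (1 - y + z) = p * (1 + y + z) := by linear_combination -hyz
  have E2 : y * (1 + z - y) = q * (1 - y - z) := by
    rw [hy]; field_simp; linear_combination 2 * hz
  have n1 := z0.ne'
  have n2 := y0.ne'
  have n3 := hT₁.ne'
  refine ⟨y, z, 2 * ((1 - y - z) * (1 + y + z)) / (T₁ * y * z), y0, z0, by positivity, ?_, ?_, ?_⟩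
  · field_simp; ring
  · rw [e2]; field_simp; linear_combination (-(1 + y + z)) * E2
  · rw [e3]; field_simp; linear_combination (-(1 - y - z)) * E1

theorem stmt11 (T₁ T₂ T₃ : ℝ) (hT₁ : 0 < T₁) (hT₂ : T₂ < 0) (hT₃ : T₃ < 0) :
    ((∃ (x : Fin 3 → ℝ) (c : ℝ), (∀ i, 0 < x i) ∧ 0 < c ∧ (∀ i, ricMilnor ![2, 2, -2] x i = c * ![T₁, T₂, T₃] i)) ↔ T₃ + T₁ > 0) ∧
    (∀ (x x' : Fin 3 → ℝ) (c c' : ℝ),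
      (∀ i, 0 < x i) → 0 < c → (∀ i, ricMilnor ![2, 2, -2] x i = c * ![T₁, T₂, T₃] i) →
      (∀ i, 0 < x' i) → 0 < c' → (∀ i, ricMilnor ![2, 2, -2] x' i = c' * ![T₁, T₂, T₃] i) →
      c = c' ∧ (∃ t : ℝ, 0 < t ∧ ∀ i, x' i = t * x i)) := by
  have main : ∀ (x : Fin 3 → ℝ) (c : ℝ), (∀ i, 0 < x i) →
      ((∀ i, ricMilnor ![2, 2, -2] x i = c * ![T₁, T₂, T₃] i) ↔ Sys T₁ T₂ T₃ (x 1 / x 0) (x 2 / x 0) c) :=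
    fun x c hx => sys_iff T₁ T₂ T₃ x c hx
  refine ⟨⟨?_, ?_⟩, ?_⟩
  · rintro ⟨x, c, hx, hc, h⟩
    have hy : 0 < x 1 / x 0 := div_pos (hx 1) (hx 0)
    have hz : 0 < x 2 / x 0 := div_pos (hx 2) (hx 0)
    obtain ⟨h1, h2, h3⟩ := sys_red hT₁ hy hz hc ((main x c hx).1 h)
    generalize x 1 / x 0 = y at *
    generalize x 2 / x 0 = z at *
    have hp : 0 < (1 + y + z - z * (1 - y + z)) := by nlinarith [mul_pos hy hz]
    have : 0 < (T₃ + T₁) * (1 + y + z) := by nlinarith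
    exact pos_of_mul_pos_left this (by positivity)
  · intro h
    obtain ⟨y, z, c, hy, hz, hc, hs⟩ := sys_exists T₁ T₂ T₃ hT₁ hT₂ hT₃ h
    have hx : ∀ i, 0 < (![1, y, z] : Fin 3 → ℝ) i := by
      intro i; fin_cases i <;> simp [hy, hz]
    refine ⟨![1, y, z], c, hx, hc, ?_⟩
    rw [main _ _ hx]
    simpa using hs
  · intro x x' c c' hx hc h hx' hc' h'
    have hy : 0 < x 1 / x 0 := div_pos (hx 1) (hx 0)
    have hz : 0 < x 2 / x 0 := div_pos (hx 2) (hx 0)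
    have hy' : 0 < x' 1 / x' 0 := div_pos (hx' 1) (hx' 0)
    have hz' : 0 < x' 2 / x' 0 := div_pos (hx' 2) (hx' 0)
    have hs := (main x c hx).1 h
    have hs' := (main x' c' hx').1 h'
    obtain ⟨h1, h2, h3⟩ := sys_red hT₁ hy hz hc hs
    obtain ⟨h1', h2', h3'⟩ := sys_red hT₁ hy' hz' hc' hs'
    have ey : x 1 / x 0 = x' 1 / x' 0 := by
      rcases lt_trichotomy (x 1 / x 0) (x' 1 / x' 0) with l | e | l
      · exact (mono_aux hT₁ hT₃ hy hz hy' hz' h1 h2 h3 h1' h2' h3' l).elim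
      · exact e
      · exact (mono_aux hT₁ hT₃ hy' hz' hy hz h1' h2' h3' h1 h2 h3 l).elim
    have ez : x 2 / x 0 = x' 2 / x' 0 := by
      rw [← ey] at h2' h1'
      rcases lt_trichotomy (x 2 / x 0) (x' 2 / x' 0) with l | e | l
      · exact (mono_z hT₁ hT₃ hy hz hz' h1 h2 h2' h1' l).elim
      · exact e
      · exact (mono_z hT₁ hT₃ hy hz' hz h1' h2' h2 h1 l).elim
    refine ⟨?_, x' 0 / x 0, div_pos (hx' 0) (hx 0), ?_⟩
    · have e1 := hs.1
      have e2 := hs'.1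
      rw [← ey, ← ez, e1] at e2
      have : T₁ * (x 1 / x 0) * (x 2 / x 0) ≠ 0 := by positivity
      apply mul_right_cancel₀ this
      linarith
    · have h0 := (hx 0).ne'
      have h0' := (hx' 0).ne'
      intro i
      fin_cases i
      · simp; field_simp
      · simp; field_simp at ey ⊢; linarith
      · simp; field_simp at ez ⊢; linarith
end

section
/- Let λ = (2,2,−2), let T₁ < 0, T₂ < 0, T₃ > 0. Then there exist x₁,x₂,x₃ > 0 and c > 0 such that R_i(λ,x) = c·T_i for i = 1,2,3 if and only if ( max{−T₁,−T₂} < T₃ or min{−T₁,−T₂} > T₃ or T₃ = −T₁ = −T₂ ). Moreover, all such solutions (x,c) have the same value of c. -/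
open scoped BigOperators

/-- The reduced system. -/
def Red (A B p q : ℝ) : Prop :=
  0 < p ∧ 0 < q ∧ p < 1 ∧ q < 1 ∧ 1 - p = A * q * (p + q) ∧ 1 - q = B * p * (p + q)

lemma red_of_w {A B w : ℝ} (hA : 0 < A) (hB : 0 < B) (hw : 0 < w)
    (h : A * B * w ^ 3 - (A + B + 1) * w + 2 = 0)
    (hs : (A * w < 1 ∧ B * w < 1) ∨ (1 < A * w ∧ 1 < B * w)) : ∃ p q, Red A B p q := by
  have hD : 1 - A * B * w ^ 2 ≠ 0 := by
    rcases hs with ⟨h1, h2⟩ | ⟨h1, h2⟩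
    · have : (A * w) * (B * w) < 1 := by
        have := mul_pos hA hw; have := mul_pos hB hw; nlinarith
      intro h; nlinarith
    · intro h; nlinarith
  have hp : 0 < (1 - A * w) / (1 - A * B * w ^ 2) ∧ 0 < (1 - B * w) / (1 - A * B * w ^ 2) := by
    rcases hs with ⟨h1, h2⟩ | ⟨h1, h2⟩
    · have : (A * w) * (B * w) < 1 := by
        have := mul_pos hA hw; have := mul_pos hB hw; nlinarith
      have : 0 < 1 - A * B * w ^ 2 := by nlinarith
      exact ⟨div_pos (by linarith) this, div_pos (by linarith) this⟩
    · have : 1 - A * B * w ^ 2 < 0 := by nlinarith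
      exact ⟨div_pos_of_neg_of_neg (by linarith) this, div_pos_of_neg_of_neg (by linarith) this⟩
  have hsum : (1 - A * w) / (1 - A * B * w ^ 2) + (1 - B * w) / (1 - A * B * w ^ 2) = w := by
    rw [← add_div, div_eq_iff hD]; linarith
  have e1 : 1 - (1 - A * w) / (1 - A * B * w ^ 2) = A * ((1 - B * w) / (1 - A * B * w ^ 2)) * w := by
    rw [one_sub_div hD, mul_div_assoc', div_mul_eq_mul_div]; congr 1; ring
  have e2 : 1 - (1 - B * w) / (1 - A * B * w ^ 2) = B * ((1 - A * w) / (1 - A * B * w ^ 2)) * w := by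
    rw [one_sub_div hD, mul_div_assoc', div_mul_eq_mul_div]; congr 1; ring
  refine ⟨(1 - A * w) / (1 - A * B * w ^ 2), (1 - B * w) / (1 - A * B * w ^ 2), hp.1, hp.2,
    ?_, ?_, by rw [hsum]; exact e1, by rw [hsum]; exact e2⟩
  · have := mul_pos (mul_pos hA hp.2) hw; linarith
  · have := mul_pos (mul_pos hB hp.1) hw; linarith

lemma red_exists_le {A B : ℝ} (hA : 0 < A) (hB : 0 < B) (hBA : B ≤ A)
    (h : (A < 1 ∧ B < 1) ∨ (1 < A ∧ 1 < B) ∨ (A = 1 ∧ B = 1)) : ∃ p q, Red A B p q := by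
  rcases hBA.eq_or_lt with rfl | hlt
  · have hc : ContinuousOn (fun q : ℝ => 2 * B * q ^ 2 + q - 1) (Set.Icc 0 1) := by fun_prop
    have := intermediate_value_Ioo (zero_le_one) hc
    obtain ⟨q, ⟨h0, h1⟩, hq⟩ := this (show (0:ℝ) ∈ _ by constructor <;> norm_num <;> linarith)
    simp only at hq
    exact ⟨q, q, h0, h0, h1, h1, by nlinarith, by nlinarith⟩
  · rcases h with ⟨h1, h2⟩ | ⟨h1, h2⟩ | ⟨h1, h2⟩
    · have hc : ContinuousOn (fun w : ℝ => A * B * w ^ 3 - (A + B + 1) * w + 2) (Set.Icc 1 (1 / A)) := by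
        fun_prop
      have h1A : 1 ≤ 1 / A := by rw [le_div_iff₀ hA]; linarith
      have := intermediate_value_Ioo' h1A hc
      have v : A * B * (1 / A) ^ 3 - (A + B + 1) * (1 / A) + 2 = (A - 1) * (A - B) / A ^ 2 := by
        field_simp; ring
      obtain ⟨w, ⟨hw0, hw1⟩, hw⟩ := this (show (0:ℝ) ∈ _ by
        constructor
        · rw [v]
          apply div_neg_of_neg_of_pos _ (by positivity)
          nlinarith
        · nlinarith)
      rw [lt_div_iff₀ hA] at hw1
      exact red_of_w hA hB (by linarith) hw (Or.inl ⟨by linarith, by nlinarith⟩)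
    · have hc : ContinuousOn (fun w : ℝ => A * B * w ^ 3 - (A + B + 1) * w + 2) (Set.Icc (1 / B) 1) := by
        fun_prop
      have h1A : 1 / B ≤ 1 := by rw [div_le_iff₀ hB]; linarith
      have := intermediate_value_Ioo h1A hc
      have v : A * B * (1 / B) ^ 3 - (A + B + 1) * (1 / B) + 2 = (B - 1) * (B - A) / B ^ 2 := by
        field_simp; ring
      obtain ⟨w, ⟨hw0, hw1⟩, hw⟩ := this (show (0:ℝ) ∈ _ by
        constructor
        · rw [v]
          apply div_neg_of_neg_of_pos _ (by positivity)
          nlinarith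
        · nlinarith)
      have hwp : 0 < w := lt_trans (by positivity) hw0
      rw [div_lt_iff₀ hB] at hw0
      exact red_of_w hA hB hwp hw (Or.inr ⟨by nlinarith, by linarith⟩)
    · linarith

lemma red_exists {A B : ℝ} (hA : 0 < A) (hB : 0 < B)
    (h : (A < 1 ∧ B < 1) ∨ (1 < A ∧ 1 < B) ∨ (A = 1 ∧ B = 1)) : ∃ p q, Red A B p q := by
  rcases le_total B A with hl | hl
  · exact red_exists_le hA hB hl h
  · obtain ⟨p, q, h1, h2, h3, h4, h5, h6⟩ := red_exists_le hB hA hl (by tauto)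
    exact ⟨q, p, h2, h1, h4, h3, by rw [add_comm q p]; exact h6, by rw [add_comm q p]; exact h5⟩

lemma red_sign {A B p q : ℝ} (h : Red A B p q) :
    (1 < p + q ∧ A < 1 ∧ B < 1 ∧ A * (p + q) < 1 ∧ B * (p + q) < 1) ∨
    (p + q < 1 ∧ 1 < A ∧ 1 < B ∧ 1 < A * (p + q) ∧ 1 < B * (p + q)) ∨
    (p + q = 1 ∧ A = 1 ∧ B = 1) := by
  obtain ⟨h1, h2, h3, h4, h5, h6⟩ := h
  have k1 : (1 - A) * (q * (p + q)) = (1 + q) * (p + q - 1) := by linear_combination h5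
  have k2 : (1 - B) * (p * (p + q)) = (1 + p) * (p + q - 1) := by linear_combination h6
  have k3 : (1 - A * (p + q)) * q = p + q - 1 := by linear_combination h5
  have k4 : (1 - B * (p + q)) * p = p + q - 1 := by linear_combination h6
  have m1 : 0 < q * (p + q) := by positivity
  have m2 : 0 < p * (p + q) := by positivity
  rcases lt_trichotomy (p + q) 1 with hw | hw | hw
  · right; left
    have n1 : (1 + q) * (p + q - 1) < 0 := mul_neg_of_pos_of_neg (by linarith) (by linarith)
    have n2 : (1 + p) * (p + q - 1) < 0 := mul_neg_of_pos_of_neg (by linarith) (by linarith)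
    refine ⟨hw, ?_, ?_, ?_, ?_⟩
    · by_contra hh; nlinarith [mul_nonneg (by linarith : 0 ≤ 1 - A) m1.le]
    · by_contra hh; nlinarith [mul_nonneg (by linarith : 0 ≤ 1 - B) m2.le]
    · by_contra hh; nlinarith [mul_nonneg (by linarith : 0 ≤ 1 - A * (p + q)) h2.le]
    · by_contra hh; nlinarith [mul_nonneg (by linarith : 0 ≤ 1 - B * (p + q)) h1.le]
  · right; right
    refine ⟨hw, ?_, ?_⟩
    · rw [hw] at k3
      have : 1 - A * 1 = 0 := by
        rcases mul_eq_zero.1 (k3.trans (sub_self 1)) with h | h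
        · exact h
        · linarith
      linarith
    · rw [hw] at k4
      have : 1 - B * 1 = 0 := by
        rcases mul_eq_zero.1 (k4.trans (sub_self 1)) with h | h
        · exact h
        · linarith
      linarith
  · left
    have n1 : 0 < (1 + q) * (p + q - 1) := mul_pos (by linarith) (by linarith)
    have n2 : 0 < (1 + p) * (p + q - 1) := mul_pos (by linarith) (by linarith)
    refine ⟨hw, ?_, ?_, ?_, ?_⟩
    · by_contra hh; nlinarith [mul_nonneg (by linarith : 0 ≤ A - 1) m1.le]
    · by_contra hh; nlinarith [mul_nonneg (by linarith : 0 ≤ B - 1) m2.le]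
    · by_contra hh; nlinarith [mul_nonneg (by linarith : 0 ≤ A * (p + q) - 1) h2.le]
    · by_contra hh; nlinarith [mul_nonneg (by linarith : 0 ≤ B * (p + q) - 1) h1.le]

lemma red_cubic {A B p q : ℝ} (h : Red A B p q) :
    A * B * (p + q) ^ 3 - (A + B + 1) * (p + q) + 2 = 0 := by
  obtain ⟨h1, h2, h3, h4, h5, h6⟩ := h
  linear_combination (1 - B * (p + q)) * h5 + (1 - A * (p + q)) * h6

lemma key {A B w v : ℝ} (hA : 0 < A) (hB : 0 < B) (hw : 0 < w) (hv : 0 < v)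
    (fw : A * B * w ^ 3 - (A + B + 1) * w + 2 = 0)
    (fv : A * B * v ^ 3 - (A + B + 1) * v + 2 = 0) (hne : w ≠ v)
    (hA1 : 0 < (1 - A * w) * (1 - A * v)) (hB1 : 0 < (1 - B * w) * (1 - B * v))
    (hs : 0 < (A - 1) * (B - 1)) : False := by
  have d : A * B * (w ^ 2 + w * v + v ^ 2) = A + B + 1 := by
    apply mul_left_cancel₀ (sub_ne_zero.2 hne)
    linear_combination fw - fv
  have e : A * B * (w * v * (w + v)) = 2 := by
    linear_combination fw * (-1) + w * d + 0 * fv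
  have a1 : B * ((1 - A * w) * (1 - A * v) * (1 + A * (w + v))) = (A - 1) * (A - B) := by
    linear_combination (-A) * d + A ^ 2 * e
  have b1 : A * ((1 - B * w) * (1 - B * v) * (1 + B * (w + v))) = (B - 1) * (B - A) := by
    linear_combination (-B) * d + B ^ 2 * e
  have a3 : 0 < (A - 1) * (A - B) := by rw [← a1]; positivity
  have b3 : 0 < (B - 1) * (B - A) := by rw [← b1]; positivity
  nlinarith [mul_pos a3 b3, mul_nonneg hs.le (sq_nonneg (A - B))]

lemma red_unique {A B p q p' q' : ℝ} (hA : 0 < A) (hB : 0 < B) (h : Red A B p q)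
    (h' : Red A B p' q') : p + q = p' + q' := by
  by_contra hne
  have s := red_sign h
  have s' := red_sign h'
  have hw : 0 < p + q := add_pos h.1 h.2.1
  have hv : 0 < p' + q' := add_pos h'.1 h'.2.1
  have K := key hA hB hw hv (red_cubic h) (red_cubic h') hne
  rcases s with ⟨a1, a2, a3, a4, a5⟩ | ⟨a1, a2, a3, a4, a5⟩ | ⟨a1, a2, a3⟩ <;>
  rcases s' with ⟨b1, b2, b3, b4, b5⟩ | ⟨b1, b2, b3, b4, b5⟩ | ⟨b1, b2, b3⟩ <;>
  first
  | exact K (mul_pos (by linarith) (by linarith)) (mul_pos (by linarith) (by linarith))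
      (mul_pos_of_neg_of_neg (by linarith) (by linarith))
  | exact K (mul_pos_of_neg_of_neg (by linarith) (by linarith))
      (mul_pos_of_neg_of_neg (by linarith) (by linarith)) (mul_pos (by linarith) (by linarith))
  | linarith
  | exact hne (by linarith)

lemma ric_iff {T₁ T₂ T₃ c : ℝ} {x : Fin 3 → ℝ} (hx : ∀ i, 0 < x i) :
    (∀ i, ricMilnor ![2, 2, -2] x i = c * ![T₁, T₂, T₃] i) ↔
    (2 * (x 0 ^ 2 - (x 1 + x 2) ^ 2) = c * T₁ * (x 1 * x 2) ∧
     2 * (x 1 ^ 2 - (x 2 + x 0) ^ 2) = c * T₂ * (x 2 * x 0) ∧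
     2 * (x 2 ^ 2 - (x 0 - x 1) ^ 2) = c * T₃ * (x 0 * x 1)) := by
  have h0 := hx 0
  have h1 := hx 1
  have h2 := hx 2
  have hd : 2 * x 0 * x 1 * x 2 ≠ 0 := by positivity
  have e1 : (1 : Fin 3) + 1 = 2 := rfl
  have e2 : (1 : Fin 3) + 2 = 0 := rfl
  have e3 : (2 : Fin 3) + 1 = 0 := rfl
  have e4 : (2 : Fin 3) + 2 = 1 := rfl
  rw [Fin.forall_fin_succ, Fin.forall_fin_two]
  simp only [ricMilnor, Fin.succ_zero_eq_one, Fin.succ_one_eq_two, zero_add, e1, e2, e3, e4,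
    div_eq_iff hd, Matrix.cons_val]
  refine and_congr ?_ (and_congr ?_ ?_)
  · constructor <;> intro h
    · apply mul_left_cancel₀ h0.ne'; linear_combination h / 2
    · linear_combination 2 * x 0 * h
  · constructor <;> intro h
    · apply mul_left_cancel₀ h1.ne'; linear_combination h / 2
    · linear_combination 2 * x 1 * h
  · constructor <;> intro h
    · apply mul_left_cancel₀ h2.ne'; linear_combination h / 2
    · linear_combination 2 * x 2 * h

lemma red_of_sol {T₁ T₂ T₃ c : ℝ} (hT₁ : T₁ < 0) (hT₂ : T₂ < 0) (hT₃ : 0 < T₃)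
    {x : Fin 3 → ℝ} (hx : ∀ i, 0 < x i) (hc : 0 < c)
    (h : ∀ i, ricMilnor ![2, 2, -2] x i = c * ![T₁, T₂, T₃] i) :
    ∃ p q, Red (-T₁ / T₃) (-T₂ / T₃) p q ∧ c * (T₁ * T₂ * (p + q) ^ 2) = 8 * T₃ := by
  obtain ⟨E1, E2, E3⟩ := (ric_iff hx).1 h
  have h0 := hx 0
  have h1 := hx 1
  have h2 := hx 2
  generalize x 0 = X at *
  generalize x 1 = Y at *
  generalize x 2 = Z at *
  have hs : 0 < X + Y + Z := by positivity
  have F1 : 2 * (X + Y + Z) * (Z - X + Y) = c * (-T₁) * (Y * Z) := by linear_combination -E1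
  have F2 : 2 * (X + Y + Z) * (Z + X - Y) = c * (-T₂) * (Z * X) := by linear_combination -E2
  have F3 : 2 * (Z - X + Y) * (Z + X - Y) = c * T₃ * (X * Y) := by linear_combination E3
  have hP : 0 < Z - X + Y := by
    have : 0 < 2 * (X + Y + Z) * (Z - X + Y) := by
      rw [F1]; have := neg_pos.2 hT₁; positivity
    exact pos_of_mul_pos_right this (by positivity)
  have hQ : 0 < Z + X - Y := by
    have : 0 < 2 * (X + Y + Z) * (Z + X - Y) := by
      rw [F2]; have := neg_pos.2 hT₂; positivity
    exact pos_of_mul_pos_right this (by positivity)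
  have w : (Z - X + Y) / (X + Y + Z) + (Z + X - Y) / (X + Y + Z) = 2 * Z / (X + Y + Z) := by
    rw [← add_div]; ring_nf
  -- T₃ s X = -T₁ Q Z
  have G1 : T₃ * (X + Y + Z) * X = -T₁ * (Z + X - Y) * Z := by
    apply mul_left_cancel₀ (show c * Y ≠ 0 by positivity)
    linear_combination (-(X + Y + Z)) * F3 + (Z + X - Y) * F1
  have G2 : T₃ * (X + Y + Z) * Y = -T₂ * (Z - X + Y) * Z := by
    apply mul_left_cancel₀ (show c * X ≠ 0 by positivity)
    linear_combination (-(X + Y + Z)) * F3 + (Z - X + Y) * F2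
  refine ⟨(Z - X + Y) / (X + Y + Z), (Z + X - Y) / (X + Y + Z),
    ⟨by positivity, by positivity, ?_, ?_, ?_, ?_⟩, ?_⟩
  · rw [div_lt_one hs]; linarith
  · rw [div_lt_one hs]; linarith
  · rw [w]; field_simp; linear_combination 2 * G1
  · rw [w]; field_simp; linear_combination 2 * G2
  · rw [w, div_pow, mul_div_assoc', mul_div_assoc', div_eq_iff (by positivity)]
    apply mul_left_cancel₀ (show c * (X * Y) ≠ 0 by positivity)
    linear_combination (8 * (X + Y + Z) ^ 2) * F3 - 4 * (c * (-T₂) * (Z * X)) * F1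
      - 4 * (2 * (X + Y + Z) * (Z - X + Y)) * F2

lemma sol_of_red {T₁ T₂ T₃ p q : ℝ} (hT₃ : 0 < T₃) (h : Red (-T₁ / T₃) (-T₂ / T₃) p q) :
    ∃ (x : Fin 3 → ℝ) (c : ℝ), (∀ i, 0 < x i) ∧ 0 < c ∧
      (∀ i, ricMilnor ![2, 2, -2] x i = c * ![T₁, T₂, T₃] i) := by
  obtain ⟨h1, h2, h3, h4, h5, h6⟩ := h
  have g1 : 0 < 1 - p := by linarith
  have g2 : 0 < 1 - q := by linarith
  have k5 : T₃ * (1 - p) = -T₁ * q * (p + q) := by rw [h5]; field_simp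
  have k6 : T₃ * (1 - q) = -T₂ * p * (p + q) := by rw [h6]; field_simp
  have hx : ∀ i, 0 < (![1 - p, 1 - q, p + q] : Fin 3 → ℝ) i := by
    intro i; fin_cases i
    · exact g1
    · exact g2
    · exact add_pos h1 h2
  refine ⟨![1 - p, 1 - q, p + q], 8 * p * q / ((1 - p) * (1 - q) * T₃), hx, by positivity, ?_⟩
  rw [ric_iff hx]
  simp only [Matrix.cons_val]
  refine ⟨?_, ?_, ?_⟩
  · field_simp
    linear_combination (-8 * p) * k5
  · field_simp
    linear_combination (-8 * q) * k6
  · field_simp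
    ring

theorem stmt12 (T₁ T₂ T₃ : ℝ) (hT₁ : T₁ < 0) (hT₂ : T₂ < 0) (hT₃ : 0 < T₃) :
    ((∃ (x : Fin 3 → ℝ) (c : ℝ), (∀ i, 0 < x i) ∧ 0 < c ∧ (∀ i, ricMilnor ![2, 2, -2] x i = c * ![T₁, T₂, T₃] i)) ↔
      (max (-T₁) (-T₂) < T₃ ∨ T₃ < min (-T₁) (-T₂) ∨ (T₃ = -T₁ ∧ T₃ = -T₂))) ∧
    (∀ (x x' : Fin 3 → ℝ) (c c' : ℝ),
      (∀ i, 0 < x i) → 0 < c → (∀ i, ricMilnor ![2, 2, -2] x i = c * ![T₁, T₂, T₃] i) →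
      (∀ i, 0 < x' i) → 0 < c' → (∀ i, ricMilnor ![2, 2, -2] x' i = c' * ![T₁, T₂, T₃] i) →
      c = c') := by
  have hA : 0 < -T₁ / T₃ := div_pos (by linarith) hT₃
  have hB : 0 < -T₂ / T₃ := div_pos (by linarith) hT₃
  refine ⟨⟨?_, ?_⟩, ?_⟩
  · rintro ⟨x, c, hx, hc, h⟩
    obtain ⟨p, q, hr, -⟩ := red_of_sol hT₁ hT₂ hT₃ hx hc h
    rcases red_sign hr with ⟨-, a, b, -, -⟩ | ⟨-, a, b, -, -⟩ | ⟨-, a, b⟩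
    · rw [div_lt_one hT₃] at a b
      exact Or.inl (max_lt a b)
    · rw [one_lt_div hT₃] at a b
      exact Or.inr (Or.inl (lt_min a b))
    · rw [div_eq_one_iff_eq hT₃.ne'] at a b
      exact Or.inr (Or.inr ⟨a.symm, b.symm⟩)
  · intro h
    have : ∃ p q, Red (-T₁ / T₃) (-T₂ / T₃) p q := by
      apply red_exists hA hB
      rw [div_lt_one hT₃, div_lt_one hT₃, one_lt_div hT₃, one_lt_div hT₃,
        div_eq_one_iff_eq hT₃.ne', div_eq_one_iff_eq hT₃.ne']
      rw [max_lt_iff, lt_min_iff] at h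
      rcases h with h | h | h
      · exact Or.inl h
      · exact Or.inr (Or.inl h)
      · exact Or.inr (Or.inr ⟨h.1.symm, h.2.symm⟩)
    obtain ⟨p, q, hr⟩ := this
    exact sol_of_red hT₃ hr
  · intro x x' c c' hx hc h hx' hc' h'
    obtain ⟨p, q, hr, e⟩ := red_of_sol hT₁ hT₂ hT₃ hx hc h
    obtain ⟨p', q', hr', e'⟩ := red_of_sol hT₁ hT₂ hT₃ hx' hc' h'
    rw [← red_unique hA hB hr hr'] at e'
    have hw : 0 < p + q := add_pos hr.1 hr.2.1
    have hT : 0 < T₁ * T₂ := mul_pos_of_neg_of_neg hT₁ hT₂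
    exact mul_right_cancel₀ (show T₁ * T₂ * (p + q) ^ 2 ≠ 0 by positivity) (e.trans e'.symm)
end

section
/- Let λ = (2,2,0), let T₁ > 0, T₂ < 0, T₃ < 0. Then there exist x₁,x₂,x₃ > 0 and c > 0 such that R_i(λ,x) = c·T_i for i = 1,2,3 if and only if T₁ + T₂ > 0. Moreover, if (x,c) and (x′,c′) are two such solutions, then c = c′ and x′ = t·x for some t > 0. -/
open scoped BigOperators

theorem aux14 (T₁ T₂ T₃ : ℝ) (hT₁ : 0 < T₁) (hT₂ : T₂ < 0) (hT₃ : T₃ < 0)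
    (x : Fin 3 → ℝ) (c : ℝ) (hx : ∀ i, 0 < x i) (hc : 0 < c)
    (h : ∀ i, ricMilnor ![2, 2, 0] x i = c * ![T₁, T₂, T₃] i) :
    0 < T₁ + T₂ ∧ c = 2 * (T₁ + T₂) ^ 2 / (T₁ * T₂ * T₃) ∧
    ∃ s : ℝ, 0 < s ∧ x 0 = s * T₁ ∧ x 1 = s * (-T₂) ∧
      x 2 = s * (-T₃ * (T₁ - T₂) / (T₁ + T₂)) := by
  have ha := hx 0
  have hb := hx 1
  have hz := hx 2
  have h0 := h 0
  have h1 := h 1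
  have h2 := h 2
  have e1 : (1 : Fin 3) + 1 = 2 := rfl
  have e2 : (1 : Fin 3) + 2 = 0 := rfl
  have e3 : (2 : Fin 3) + 1 = 0 := rfl
  have e4 : (2 : Fin 3) + 2 = 1 := rfl
  simp [ricMilnor, e1, e2, e3, e4] at h0 h1 h2
  generalize x 0 = a at *
  generalize x 1 = b at *
  generalize x 2 = z at *
  clear h hx
  have hp : 2 * a * b * z ≠ 0 := by positivity
  rw [div_eq_iff hp] at h0 h1 h2
  have g0 : 2 * (a ^ 2 - b ^ 2) = c * T₁ * (b * z) := by
    apply mul_left_cancel₀ ha.ne'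
    linarith
  have g1 : -2 * (a ^ 2 - b ^ 2) = c * T₂ * (a * z) := by
    apply mul_left_cancel₀ hb.ne'
    linarith
  have g2 : -2 * (a - b) ^ 2 = c * T₃ * (a * b) := by
    apply mul_left_cancel₀ hz.ne'
    linarith
  have k : T₁ * b = -T₂ * a := by
    apply mul_left_cancel₀ (mul_pos hc hz).ne'
    linarith
  obtain ⟨s, hs⟩ : ∃ s, s = a / T₁ := ⟨_, rfl⟩
  have hs0 : 0 < s := by rw [hs]; positivity
  have hA : a = s * T₁ := by rw [hs]; field_simp
  have hB : b = s * (-T₂) := by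
    apply mul_left_cancel₀ hT₁.ne'
    rw [k, hA]; ring
  have hpos : 0 < a ^ 2 - b ^ 2 := by
    have : 0 < c * T₁ * (b * z) := by positivity
    linarith
  have hab : 0 < a - b := by
    by_contra hn
    nlinarith
  have hS : 0 < T₁ + T₂ := by
    rw [hA, hB] at hab
    by_contra hn
    nlinarith
  have hTT : 0 < T₁ * T₂ * T₃ := by
    rw [mul_assoc]; exact mul_pos hT₁ (mul_pos_of_neg_of_neg hT₂ hT₃)
  subst hA hB
  have hc' : c * (T₁ * T₂ * T₃) = 2 * (T₁ + T₂) ^ 2 := by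
    apply mul_left_cancel₀ (pow_pos hs0 2).ne'
    linarith
  refine ⟨hS, (eq_div_iff hTT.ne').2 hc', s, hs0, rfl, rfl, ?_⟩
  rw [← mul_div_assoc, eq_div_iff hS.ne']
  apply mul_left_cancel₀ (mul_pos hs0 (mul_pos two_pos hS)).ne'
  linear_combination (-s * z) * hc' + T₃ * g0

theorem stmt14 (T₁ T₂ T₃ : ℝ) (hT₁ : 0 < T₁) (hT₂ : T₂ < 0) (hT₃ : T₃ < 0) :
    ((∃ (x : Fin 3 → ℝ) (c : ℝ), (∀ i, 0 < x i) ∧ 0 < c ∧ (∀ i, ricMilnor ![2, 2, 0] x i = c * ![T₁, T₂, T₃] i)) ↔ T₁ + T₂ > 0) ∧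
    (∀ (x x' : Fin 3 → ℝ) (c c' : ℝ),
      (∀ i, 0 < x i) → 0 < c → (∀ i, ricMilnor ![2, 2, 0] x i = c * ![T₁, T₂, T₃] i) →
      (∀ i, 0 < x' i) → 0 < c' → (∀ i, ricMilnor ![2, 2, 0] x' i = c' * ![T₁, T₂, T₃] i) →
      c = c' ∧ (∃ t : ℝ, 0 < t ∧ ∀ i, x' i = t * x i)) := by
  refine ⟨⟨?_, ?_⟩, ?_⟩
  · rintro ⟨x, c, hx, hc, h⟩
    exact (aux14 T₁ T₂ T₃ hT₁ hT₂ hT₃ x c hx hc h).1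
  · intro hS
    have hS' : 0 < T₁ + T₂ := hS
    have hTT : 0 < T₁ * T₂ * T₃ := by
      rw [mul_assoc]; exact mul_pos hT₁ (mul_pos_of_neg_of_neg hT₂ hT₃)
    have hD : 0 < T₁ - T₂ := by linarith
    have hD' := hD.ne'
    have hS'' := hS'.ne'
    have n1 := hT₁.ne'
    have n2 := hT₂.ne
    have n3 := hT₃.ne
    refine ⟨![T₁, -T₂, -T₃ * (T₁ - T₂) / (T₁ + T₂)],
      2 * (T₁ + T₂) ^ 2 / (T₁ * T₂ * T₃), ?_, by positivity, ?_⟩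
    · intro i
      fin_cases i
      · simpa using hT₁
      · simpa using hT₂
      · exact div_pos (mul_pos (neg_pos.2 hT₃) hD) hS'
    · have e1 : (1 : Fin 3) + 1 = 2 := rfl
      have e2 : (1 : Fin 3) + 2 = 0 := rfl
      have e3 : (2 : Fin 3) + 1 = 0 := rfl
      have e4 : (2 : Fin 3) + 2 = 1 := rfl
      intro i
      fin_cases i <;> simp [ricMilnor, e1, e2, e3, e4] <;> field_simp <;> ring
  · intro x x' c c' hx hc h hx' hc' h'
    obtain ⟨-, e, s, hs, a0, a1, a2⟩ := aux14 T₁ T₂ T₃ hT₁ hT₂ hT₃ x c hx hc h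
    obtain ⟨-, e', s', hs', b0, b1, b2⟩ := aux14 T₁ T₂ T₃ hT₁ hT₂ hT₃ x' c' hx' hc' h'
    refine ⟨e.trans e'.symm, s' / s, div_pos hs' hs, ?_⟩
    intro i
    have key : ∀ u : ℝ, s' * u = s' / s * (s * u) := by
      intro u
      field_simp
    fin_cases i
    · change x' 0 = s' / s * x 0
      rw [a0, b0]; exact key _
    · change x' 1 = s' / s * x 1
      rw [a1, b1]; exact key _
    · change x' 2 = s' / s * x 2
      rw [a2, b2]; exact key _
end

section
/- Let λ = (2,−2,0), let T₁ = T₂ = 0 and T₃ < 0. Then there exist x₁,x₂,x₃ > 0 and c > 0 such that R_i(λ,x) = c·T_i for i = 1,2,3. Moreover, all such solutions (x,c) have the same value of c, and there exist two solutions (x,c) and (x′,c) such that x′ is not a positive scalar multiple of x. -/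
open scoped BigOperators

theorem aux_sol_s15 (T₃ : ℝ) (hT₃ : T₃ < 0) (s : ℝ) (hs : 0 < s) :
    (∀ i, 0 < (![1, 1, s] : Fin 3 → ℝ) i) ∧ 0 < -8 / T₃ ∧
      (∀ i, ricMilnor ![2, -2, 0] ![1, 1, s] i = (-8 / T₃) * ![0, 0, T₃] i) := by
  refine ⟨?_, div_pos_of_neg_of_neg (by norm_num) hT₃, ?_⟩
  · intro i
    fin_cases i <;> simp [hs]
  · intro i
    have h1 : (1 : Fin 3) + 1 = 2 := rfl
    have h2 : (1 : Fin 3) + 2 = 0 := rfl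
    have h3 : (2 : Fin 3) + 1 = 0 := rfl
    have h4 : (2 : Fin 3) + 2 = 1 := rfl
    have := hT₃.ne
    have := hs.ne'
    fin_cases i <;> simp [ricMilnor, h1, h2, h3, h4] <;> field_simp <;> norm_num

theorem aux_uniq (T₃ : ℝ) (x : Fin 3 → ℝ) (c : ℝ) (hx : ∀ i, 0 < x i)
    (h : ∀ i, ricMilnor ![2, -2, 0] x i = c * ![0, 0, T₃] i) : c * T₃ = -8 := by
  have h3 : (2 : Fin 3) + 1 = 0 := rfl
  have h4 : (2 : Fin 3) + 2 = 1 := rfl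
  have p0 := hx 0
  have p1 := hx 1
  have p2 := hx 2
  have e0 := h 0
  have e2 := h 2
  simp only [ricMilnor, h3, h4, zero_add, Matrix.cons_val] at e0 e2
  rw [mul_zero, div_eq_zero_iff] at e0
  have hd : 2 * x 0 * x 1 * x 2 ≠ 0 := by positivity
  have e0' := e0.resolve_right hd
  have e0'' := (mul_eq_zero.mp e0').resolve_left p0.ne'
  have h01 : x 0 = x 1 := by nlinarith
  rw [← e2, h01]
  field_simp
  ring

theorem stmt15 (T₃ : ℝ) (hT₃ : T₃ < 0) :
    (∃ (x : Fin 3 → ℝ) (c : ℝ), (∀ i, 0 < x i) ∧ 0 < c ∧ (∀ i, ricMilnor ![2, -2, 0] x i = c * ![0, 0, T₃] i)) ∧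
    (∀ (x x' : Fin 3 → ℝ) (c c' : ℝ),
      (∀ i, 0 < x i) → 0 < c → (∀ i, ricMilnor ![2, -2, 0] x i = c * ![0, 0, T₃] i) →
      (∀ i, 0 < x' i) → 0 < c' → (∀ i, ricMilnor ![2, -2, 0] x' i = c' * ![0, 0, T₃] i) →
      c = c') ∧
    (∃ (x x' : Fin 3 → ℝ) (c : ℝ),
      ((∀ i, 0 < x i) ∧ 0 < c ∧ (∀ i, ricMilnor ![2, -2, 0] x i = c * ![0, 0, T₃] i)) ∧
      ((∀ i, 0 < x' i) ∧ 0 < c ∧ (∀ i, ricMilnor ![2, -2, 0] x' i = c * ![0, 0, T₃] i)) ∧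
      ¬ (∃ t : ℝ, 0 < t ∧ ∀ i, x' i = t * x i)) := by
  refine ⟨⟨_, _, aux_sol_s15 T₃ hT₃ 1 one_pos⟩, ?_,
    ⟨_, _, _, aux_sol_s15 T₃ hT₃ 1 one_pos, aux_sol_s15 T₃ hT₃ 2 two_pos, ?_⟩⟩
  · intro x x' c c' hx _ h hx' _ h'
    exact mul_right_cancel₀ hT₃.ne
      ((aux_uniq T₃ x c hx h).trans (aux_uniq T₃ x' c' hx' h').symm)
  · rintro ⟨t, _, ht⟩
    have a := ht 0
    have b := ht 2
    simp only [Matrix.cons_val] at a b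
    linarith
end
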